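/- arXiv:2011.01692 — 7 statements merged into one kernel-verified Lean document; each statement's English description precedes it below -/
import Mathlib

section
/- Let N ≥ 1, λ₁, λ₃ ∈ ℝ, and let m = (m₁,m₂,m₃) : ℝᴺ × I → S² be a smooth solution of the anisotropic Landau–Lifshitz equation ∂ₜm + m × (Δm − λ₁ m₁ e₁ − λ₃ m₃ e₃) = 0 such that m₁² + m₂² > 0 everywhere on ℝᴺ × I. Suppose φ : ℝᴺ × I → ℝ is a smooth function such that m₁ + i m₂ = (1 − m₃²)^{1/2}(sin φ + i cos φ). Then, setting u = m₃, the pair (u, φ) satisfies pointwise the hydrodynamical system: ∂ₜu = div((1 − u²)∇φ) − (λ₁/2)(1 − u²) sin(2φ) and ∂ₜφ = −div(∇u/(1 − u²)) + u |∇u|²/(1 − u²)² − u |∇φ|² + u(λ₃ − λ₁ sin²(φ)). -/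
noncomputable section

open Real MeasureTheory Filter Topology

/-- `E3` is `ℝ³` with the Euclidean norm. -/
abbrev E3 : Type := EuclideanSpace ℝ (Fin 3)

def toE3 (v : Fin 3 → ℝ) : E3 := (WithLp.equiv 2 (Fin 3 → ℝ)).symm v

/-- The cross product in `ℝ³`. -/
def cross (a b : E3) : E3 :=
  toE3 ![a 1 * b 2 - a 2 * b 1, a 2 * b 0 - a 0 * b 2, a 0 * b 1 - a 1 * b 0]

def e1 : E3 := EuclideanSpace.single 0 1
def e3 : E3 := EuclideanSpace.single 2 1

/-- Partial derivative of `f` in the `j`-th coordinate direction. -/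
def pd {N : ℕ} {V : Type*} [NormedAddCommGroup V] [NormedSpace ℝ V]
    (f : EuclideanSpace ℝ (Fin N) → V) (j : Fin N) : EuclideanSpace ℝ (Fin N) → V :=
  fun x => fderiv ℝ f x (EuclideanSpace.single j 1)

/-- The Laplacian, acting componentwise. -/
def lap {N : ℕ} {V : Type*} [NormedAddCommGroup V] [NormedSpace ℝ V]
    (f : EuclideanSpace ℝ (Fin N) → V) (x : EuclideanSpace ℝ (Fin N)) : V :=
  ∑ j, pd (pd f j) j x

theorem hasDerivAt_line_pd {N : ℕ} {f : EuclideanSpace ℝ (Fin N) → ℝ}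
    {x : EuclideanSpace ℝ (Fin N)} (hf : DifferentiableAt ℝ f x) (j : Fin N) :
    HasDerivAt (fun s : ℝ => f (x + s • EuclideanSpace.single j 1)) (pd f j x) 0 :=
  hf.hasFDerivAt.hasLineDerivAt _

theorem pd_eq_of_hasDerivAt_line {N : ℕ} {f : EuclideanSpace ℝ (Fin N) → ℝ}
    {x : EuclideanSpace ℝ (Fin N)} (hf : DifferentiableAt ℝ f x) {j : Fin N} {d : ℝ}
    (hd : HasDerivAt (fun s : ℝ => f (x + s • EuclideanSpace.single j 1)) d 0) :
    pd f j x = d :=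
  (hasDerivAt_line_pd hf j).unique hd

theorem contDiff_pd {N : ℕ} {V : Type*} [NormedAddCommGroup V] [NormedSpace ℝ V]
    {f : EuclideanSpace ℝ (Fin N) → V} (hf : ContDiff ℝ (⊤ : ℕ∞) f) (j : Fin N) :
    ContDiff ℝ (⊤ : ℕ∞) (pd f j) :=
  (hf.fderiv_right (by simp)).clm_apply contDiff_const

theorem pd_apply {N n : ℕ} {f : EuclideanSpace ℝ (Fin N) → EuclideanSpace ℝ (Fin n)}
    {x : EuclideanSpace ℝ (Fin N)} (hf : DifferentiableAt ℝ f x) (j : Fin N) (i : Fin n) :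
    pd f j x i = pd (fun y => f y i) j x := by
  have h := (EuclideanSpace.proj i : EuclideanSpace ℝ (Fin n) →L[ℝ] ℝ).hasFDerivAt.comp x
    hf.hasFDerivAt
  have h' : fderiv ℝ (fun y => f y i) x = _ := h.fderiv
  simp [pd, h']

theorem lap_apply {N n : ℕ} {f : EuclideanSpace ℝ (Fin N) → EuclideanSpace ℝ (Fin n)}
    (hf : ContDiff ℝ (⊤ : ℕ∞) f) (x : EuclideanSpace ℝ (Fin N)) (i : Fin n) :
    lap f x i = ∑ j, pd (pd (fun y => f y i) j) j x := by
  have h1 : ∀ j, (fun y => pd f j y i) = pd (fun y => f y i) j := fun j =>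
    funext fun y => pd_apply (hf.differentiable (by simp) y) j i
  simp only [lap, WithLp.ofLp_sum, Finset.sum_apply]
  refine Finset.sum_congr rfl fun j _ => ?_
  rw [pd_apply ((contDiff_pd hf j).differentiable (by simp) x), h1]

/-- The derivative of the angle in polar coordinates of radius `√(1 - u²)`. -/
theorem angle_deriv_identity {a b u θ : ℝ → ℝ} {a' b' u' θ' s : ℝ}
    (hab : ∀ᶠ r in 𝓝 s, a r = √(1 - u r ^ 2) * Real.sin (θ r) ∧
      b r = √(1 - u r ^ 2) * Real.cos (θ r))
    (hu : 0 < 1 - u s ^ 2)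
    (ha' : HasDerivAt a a' s) (hb' : HasDerivAt b b' s) (hu' : HasDerivAt u u' s)
    (hθ' : HasDerivAt θ θ' s) :
    a s * b' - b s * a' = -((1 - u s ^ 2) * θ') := by
  have hr := ((hu'.pow 2).const_sub 1).sqrt hu.ne'
  have ha := ha'.unique ((hr.mul hθ'.sin).congr_of_eventuallyEq (hab.mono fun _ h => h.1))
  have hb := hb'.unique ((hr.mul hθ'.cos).congr_of_eventuallyEq (hab.mono fun _ h => h.2))
  obtain ⟨h1, h2⟩ := hab.self_of_nhds
  have hsq := Real.sq_sqrt hu.le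
  have htrig := Real.sin_sq_add_cos_sq (θ s)
  simp only [Pi.pow_apply] at ha hb
  rw [ha, hb, h1, h2]
  linear_combination (-θ' * (Real.sin (θ s) ^ 2 + Real.cos (θ s) ^ 2)) * hsq
    - (1 - u s ^ 2) * θ' * htrig

section Direction

variable {N : ℕ} {a b u φ : EuclideanSpace ℝ (Fin N) → ℝ}

theorem pd_angle_identity (ha : Differentiable ℝ a) (hb : Differentiable ℝ b)
    (hu : Differentiable ℝ u) (hφ : Differentiable ℝ φ) (hq : ∀ y, 0 < 1 - u y ^ 2)
    (hab : ∀ y, a y = √(1 - u y ^ 2) * Real.sin (φ y) ∧ b y = √(1 - u y ^ 2) * Real.cos (φ y))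
    (j : Fin N) (y : EuclideanSpace ℝ (Fin N)) :
    a y * pd b j y - b y * pd a j y = -((1 - u y ^ 2) * pd φ j y) := by
  have h := angle_deriv_identity (Eventually.of_forall fun s =>
    hab (y + s • EuclideanSpace.single j 1)) (by simpa using hq y) (hasDerivAt_line_pd (ha y) j)
    (hasDerivAt_line_pd (hb y) j) (hasDerivAt_line_pd (hu y) j) (hasDerivAt_line_pd (hφ y) j)
  simpa using h

theorem pd_sphere_identity (ha : Differentiable ℝ a) (hb : Differentiable ℝ b)
    (hu : Differentiable ℝ u) (hs : ∀ y, a y ^ 2 + b y ^ 2 + u y ^ 2 = 1)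
    (j : Fin N) (y : EuclideanSpace ℝ (Fin N)) :
    a y * pd a j y + b y * pd b j y + u y * pd u j y = 0 := by
  have h := (((hasDerivAt_line_pd (ha y) j).pow 2).add
    ((hasDerivAt_line_pd (hb y) j).pow 2)).add ((hasDerivAt_line_pd (hu y) j).pow 2)
  have h0 := h.unique ((hasDerivAt_const (0 : ℝ) (1 : ℝ)).congr_of_eventuallyEq
    (Eventually.of_forall fun s => hs (y + s • EuclideanSpace.single j 1)))
  simp at h0
  linear_combination h0 / 2

theorem pd_angle_flux (ha : ContDiff ℝ (⊤ : ℕ∞) a) (hb : ContDiff ℝ (⊤ : ℕ∞) b)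
    (hu : ContDiff ℝ (⊤ : ℕ∞) u) (hφ : ContDiff ℝ (⊤ : ℕ∞) φ) (hq : ∀ y, 0 < 1 - u y ^ 2)
    (hab : ∀ y, a y = √(1 - u y ^ 2) * Real.sin (φ y) ∧ b y = √(1 - u y ^ 2) * Real.cos (φ y))
    (j : Fin N) (x : EuclideanSpace ℝ (Fin N)) :
    pd (fun y => (1 - u y ^ 2) * pd φ j y) j x =
      b x * pd (pd a j) j x - a x * pd (pd b j) j x := by
  have hda := ha.differentiable (by simp)
  have hdb := hb.differentiable (by simp)
  have hpa := (contDiff_pd ha j).differentiable (by simp)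
  have hpb := (contDiff_pd hb j).differentiable (by simp)
  have heq : (fun y => (1 - u y ^ 2) * pd φ j y) =
      fun y => b y * pd a j y - a y * pd b j y := by
    funext y
    have := pd_angle_identity hda hdb (hu.differentiable (by simp))
      (hφ.differentiable (by simp)) hq hab j y
    linear_combination this
  rw [heq]
  refine pd_eq_of_hasDerivAt_line (((hdb x).mul (hpa x)).sub ((hda x).mul (hpb x))) ?_
  have h := ((hasDerivAt_line_pd (hdb x) j).mul (hasDerivAt_line_pd (hpa x) j)).sub
    ((hasDerivAt_line_pd (hda x) j).mul (hasDerivAt_line_pd (hpb x) j))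
  refine h.congr_deriv ?_
  simp
  ring

theorem pd_sphere_second (ha : ContDiff ℝ (⊤ : ℕ∞) a) (hb : ContDiff ℝ (⊤ : ℕ∞) b)
    (hu : ContDiff ℝ (⊤ : ℕ∞) u) (hs : ∀ y, a y ^ 2 + b y ^ 2 + u y ^ 2 = 1)
    (j : Fin N) (x : EuclideanSpace ℝ (Fin N)) :
    a x * pd (pd a j) j x + b x * pd (pd b j) j x + u x * pd (pd u j) j x +
      (pd a j x ^ 2 + pd b j x ^ 2 + pd u j x ^ 2) = 0 := by
  have hda := ha.differentiable (by simp)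
  have hdb := hb.differentiable (by simp)
  have hdu := hu.differentiable (by simp)
  have hpa := (contDiff_pd ha j).differentiable (by simp)
  have hpb := (contDiff_pd hb j).differentiable (by simp)
  have hpu := (contDiff_pd hu j).differentiable (by simp)
  have h := (((hasDerivAt_line_pd (hda x) j).mul (hasDerivAt_line_pd (hpa x) j)).add
    ((hasDerivAt_line_pd (hdb x) j).mul (hasDerivAt_line_pd (hpb x) j))).add
    ((hasDerivAt_line_pd (hdu x) j).mul (hasDerivAt_line_pd (hpu x) j))
  have h0 := h.unique ((hasDerivAt_const (0 : ℝ) (0 : ℝ)).congr_of_eventuallyEq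
    (Eventually.of_forall fun s => pd_sphere_identity hda hdb hdu hs j
      (x + s • EuclideanSpace.single j 1)))
  simp at h0
  linear_combination h0

theorem pd_div_one_sub_sq (hu : ContDiff ℝ (⊤ : ℕ∞) u) (hq : ∀ y, 0 < 1 - u y ^ 2)
    (j : Fin N) (x : EuclideanSpace ℝ (Fin N)) :
    pd (fun y => pd u j y / (1 - u y ^ 2)) j x =
      (pd (pd u j) j x * (1 - u x ^ 2) + 2 * u x * pd u j x ^ 2) / (1 - u x ^ 2) ^ 2 := by
  have hdu := hu.differentiable (by simp)
  have hpu := (contDiff_pd hu j).differentiable (by simp)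
  have hquot : DifferentiableAt ℝ (fun y => pd u j y / (1 - u y ^ 2)) x := by
    simp only [div_eq_mul_inv]
    exact (hpu x).fun_mul ((((hdu x).fun_pow 2).const_sub 1).fun_inv (hq x).ne')
  refine pd_eq_of_hasDerivAt_line hquot ?_
  have h := (hasDerivAt_line_pd (hpu x) j).div
    (((hasDerivAt_line_pd (hdu x) j).pow 2).const_sub 1) (by simpa using (hq x).ne')
  refine h.congr_deriv ?_
  simp
  ring

theorem pd_angle_dynamics (ha : ContDiff ℝ (⊤ : ℕ∞) a) (hb : ContDiff ℝ (⊤ : ℕ∞) b)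
    (hu : ContDiff ℝ (⊤ : ℕ∞) u) (hφ : ContDiff ℝ (⊤ : ℕ∞) φ) (hq : ∀ y, 0 < 1 - u y ^ 2)
    (hs : ∀ y, a y ^ 2 + b y ^ 2 + u y ^ 2 = 1)
    (hab : ∀ y, a y = √(1 - u y ^ 2) * Real.sin (φ y) ∧ b y = √(1 - u y ^ 2) * Real.cos (φ y))
    (j : Fin N) (x : EuclideanSpace ℝ (Fin N)) :
    -((1 - u x ^ 2) * pd (pd u j) j x)
        + u x * (a x * pd (pd a j) j x + b x * pd (pd b j) j x) =
      (1 - u x ^ 2) * (-pd (fun y => pd u j y / (1 - u y ^ 2)) j x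
        + u x * pd u j x ^ 2 / (1 - u x ^ 2) ^ 2 - u x * pd φ j x ^ 2) := by
  have hda := ha.differentiable (by simp)
  have hdb := hb.differentiable (by simp)
  have hdu := hu.differentiable (by simp)
  have h1 := pd_angle_identity hda hdb hdu (hφ.differentiable (by simp)) hq hab j x
  have h2 := pd_sphere_identity hda hdb hdu hs j x
  have h3 := pd_sphere_second ha hb hu hs j x
  have hsx := hs x
  have hq0 := (hq x).ne'
  rw [pd_div_one_sub_sq hu hq]
  generalize pd (pd a j) j x = A at *
  generalize pd (pd b j) j x = B at *
  generalize pd (pd u j) j x = U at *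
  generalize pd a j x = a' at *
  generalize pd b j x = b' at *
  generalize pd u j x = u' at *
  generalize pd φ j x = f at *
  generalize a x = a at *
  generalize b x = b at *
  generalize u x = u at *
  have hgrad : (1 - u ^ 2) * (a' ^ 2 + b' ^ 2) = u ^ 2 * u' ^ 2 + (1 - u ^ 2) ^ 2 * f ^ 2 := by
    linear_combination (-(a' ^ 2 + b' ^ 2)) * hsx + (a * a' + b * b' - u * u') * h2
      + (a * b' - b * a' - (1 - u ^ 2) * f) * h1
  field_simp
  linear_combination u * (1 - u ^ 2) * h3 - u * hgrad

end Direction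

/-- the hydrodynamical formulation of the anisotropic Landau–Lifshitz equation.
If `m` is a smooth solution with `m₁² + m₂² > 0` and `m₁ + i m₂ = (1-m₃²)^{1/2}(sin φ + i cos φ)`,
then `(u, φ)` with `u = m₃` solves the hydrodynamical system (H). -/
theorem LL_hydrodynamical_formulation
    (N : ℕ) (hN : 1 ≤ N) (lam1 lam3 : ℝ)
    (I : Set ℝ) (hIopen : IsOpen I) (hIconn : I.OrdConnected)
    (m : EuclideanSpace ℝ (Fin N) → ℝ → E3)
    (hsmooth : ContDiffOn ℝ (⊤ : ℕ∞)
      (fun p : EuclideanSpace ℝ (Fin N) × ℝ => m p.1 p.2) (Set.univ ×ˢ I))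
    (hsph : ∀ x, ∀ t ∈ I, ‖m x t‖ = 1)
    (hLL : ∀ x, ∀ t ∈ I,
      deriv (m x) t +
        cross (m x t)
          (lap (fun y => m y t) x - (lam1 * m x t 0) • e1 - (lam3 * m x t 2) • e3) = 0)
    (hnv : ∀ x, ∀ t ∈ I, 0 < m x t 0 ^ 2 + m x t 1 ^ 2)
    (φ : EuclideanSpace ℝ (Fin N) → ℝ → ℝ)
    (hφsmooth : ContDiffOn ℝ (⊤ : ℕ∞)
      (fun p : EuclideanSpace ℝ (Fin N) × ℝ => φ p.1 p.2) (Set.univ ×ˢ I))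
    (hφ : ∀ x, ∀ t ∈ I,
      m x t 0 = Real.sqrt (1 - m x t 2 ^ 2) * Real.sin (φ x t) ∧
      m x t 1 = Real.sqrt (1 - m x t 2 ^ 2) * Real.cos (φ x t)) :
    ∀ x, ∀ t ∈ I,
      (deriv (fun s => m x s 2) t =
        (∑ j, pd (fun y => (1 - m y t 2 ^ 2) * pd (fun z => φ z t) j y) j x)
          - (lam1 / 2) * (1 - m x t 2 ^ 2) * Real.sin (2 * φ x t)) ∧
      (deriv (φ x) t =
        -(∑ j, pd (fun y => pd (fun z => m z t 2) j y / (1 - m y t 2 ^ 2)) j x)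
          + m x t 2 * (∑ j, pd (fun z => m z t 2) j x ^ 2) / (1 - m x t 2 ^ 2) ^ 2
          - m x t 2 * (∑ j, pd (fun z => φ z t) j x ^ 2)
          + m x t 2 * (lam3 - lam1 * Real.sin (φ x t) ^ 2)) := by
  intro x t ht
  have hopen : IsOpen ((Set.univ : Set (EuclideanSpace ℝ (Fin N))) ×ˢ I) :=
    isOpen_univ.prod hIopen
  have hm_at : ∀ y, ContDiffAt ℝ (⊤ : ℕ∞)
      (fun p : EuclideanSpace ℝ (Fin N) × ℝ => m p.1 p.2) (y, t) := fun y =>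
    hsmooth.contDiffAt (hopen.mem_nhds ⟨Set.mem_univ _, ht⟩)
  have hφ_at : ∀ y, ContDiffAt ℝ (⊤ : ℕ∞)
      (fun p : EuclideanSpace ℝ (Fin N) × ℝ => φ p.1 p.2) (y, t) := fun y =>
    hφsmooth.contDiffAt (hopen.mem_nhds ⟨Set.mem_univ _, ht⟩)
  have hmx : ContDiff ℝ (⊤ : ℕ∞) (fun y => m y t) := contDiff_iff_contDiffAt.2 fun y =>
    (hm_at y).comp y (contDiffAt_id.prodMk contDiffAt_const)
  have hφx : ContDiff ℝ (⊤ : ℕ∞) (fun y => φ y t) := contDiff_iff_contDiffAt.2 fun y =>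
    (hφ_at y).comp y (contDiffAt_id.prodMk contDiffAt_const)
  have hmt : DifferentiableAt ℝ (m x) t :=
    ((hm_at x).comp t (contDiffAt_const.prodMk contDiffAt_id)).differentiableAt (by simp)
  have hφt : DifferentiableAt ℝ (φ x) t :=
    ((hφ_at x).comp t (contDiffAt_const.prodMk contDiffAt_id)).differentiableAt (by simp)
  have hci : ∀ i, ContDiff ℝ (⊤ : ℕ∞) (fun y => m y t i) := fun i =>
    (EuclideanSpace.proj i : E3 →L[ℝ] ℝ).contDiff.comp hmx
  have hdi : ∀ i, HasDerivAt (fun s => m x s i) (deriv (m x) t i) t := fun i =>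
    (EuclideanSpace.proj i : E3 →L[ℝ] ℝ).hasFDerivAt.comp_hasDerivAt t
      hmt.hasDerivAt
  have hs : ∀ y, m y t 0 ^ 2 + m y t 1 ^ 2 + m y t 2 ^ 2 = 1 := fun y => by
    have h := EuclideanSpace.real_norm_sq_eq (m y t)
    rw [hsph y t ht, Fin.sum_univ_three] at h
    linarith
  have hq : ∀ y, 0 < 1 - m y t 2 ^ 2 := fun y => by
    have := hs y
    have := hnv y t ht
    linarith
  have hab := fun y => hφ y t ht
  have htime := angle_deriv_identity (θ := φ x)
    (mem_of_superset (hIopen.mem_nhds ht) fun s h => hφ x s h) (hq x) (hdi 0) (hdi 1)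
    (hdi 2) hφt.hasDerivAt
  have hcomp : ∀ i, (deriv (m x) t + cross (m x t)
      (lap (fun y => m y t) x - (lam1 * m x t 0) • e1 - (lam3 * m x t 2) • e3)) i = 0 := fun i => by
    rw [hLL x t ht]; rfl
  have hc0 := hcomp 0
  have hc1 := hcomp 1
  have hc2 := hcomp 2
  simp [cross, toE3, e1, e3, lap_apply hmx] at hc0 hc1 hc2
  have hq0 := (hq x).ne'
  obtain ⟨h0, h1⟩ := hab x
  have hsq := Real.sq_sqrt (hq x).le
  constructor
  · rw [(hdi 2).deriv, Finset.sum_congr rfl fun j _ =>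
      pd_angle_flux (hci 0) (hci 1) (hci 2) hφx hq hab j x,
      Finset.sum_sub_distrib, ← Finset.mul_sum, ← Finset.mul_sum, Real.sin_two_mul]
    have h01 : m x t 0 * m x t 1
        = (1 - m x t 2 ^ 2) * Real.sin (φ x t) * Real.cos (φ x t) := by
      rw [← hsq, h0, h1]
      ring
    linear_combination hc2 - lam1 * h01
  · have hsum := Finset.sum_congr (rfl : (Finset.univ : Finset (Fin N)) = Finset.univ) fun j _ =>
      pd_angle_dynamics (hci 0) (hci 1) (hci 2) hφx hq hs hab j x
    have hsin : m x t 0 ^ 2 = (1 - m x t 2 ^ 2) * Real.sin (φ x t) ^ 2 := by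
      rw [h0, mul_pow, hsq]
    simp only [Finset.sum_add_distrib, Finset.sum_sub_distrib, Finset.sum_neg_distrib,
      ← Finset.mul_sum, ← Finset.sum_div] at hsum
    refine mul_left_cancel₀ hq0 ?_
    linear_combination htime + m x t 1 * hc0 - m x t 0 * hc1 + hsum
      - ((∑ j, pd (pd (fun y => m y t 2) j) j x) - lam3 * m x t 2) * hs x
      - m x t 2 * lam1 * hsin
end
end

section
/- For every c ∈ (−1,1), the map u_c : ℝ → S² defined by u_c(x) = (c sech(√(1−c²) x), tanh(√(1−c²) x), √(1−c²) sech(√(1−c²) x)) satisfies −c u_c′ + u_c × (u_c″ − [u_c]₃ e₃) = 0 on ℝ; consequently, m(x,t) := u_c(x − ct) is a traveling-wave (soliton) solution of the one-dimensional easy-plane Landau–Lifshitz equation ∂ₜm + m × (∂ₓₓm − m₃ e₃) = 0. -/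
noncomputable section

open Real MeasureTheory Filter Topology

/-- The hyperbolic secant. -/
def sech (x : ℝ) : ℝ := 1 / Real.cosh x

theorem hasDerivAt_toE3 {f₀ f₁ f₂ : ℝ → ℝ} {a₀ a₁ a₂ x : ℝ} (h₀ : HasDerivAt f₀ a₀ x)
    (h₁ : HasDerivAt f₁ a₁ x) (h₂ : HasDerivAt f₂ a₂ x) :
    HasDerivAt (fun y => toE3 ![f₀ y, f₁ y, f₂ y]) (toE3 ![a₀, a₁, a₂]) x := by
  refine (EuclideanSpace.equiv (Fin 3) ℝ).symm.hasFDerivAt.comp_hasDerivAt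
    (f := fun y => ![f₀ y, f₁ y, f₂ y]) (f' := ![a₀, a₁, a₂]) x (hasDerivAt_pi.2 fun i => ?_)
  fin_cases i
  exacts [h₀, h₁, h₂]

theorem hasDerivAt_sech_mul (k x : ℝ) :
    HasDerivAt (fun y => sech (k * y)) (-k * (sech (k * x) * Real.tanh (k * x))) x := by
  have hc := (Real.cosh_pos (k * x)).ne'
  have h := (((hasDerivAt_id x).const_mul k).cosh).inv hc
  simp only [sech, one_div]
  refine h.congr_deriv ?_
  rw [Real.tanh_eq_sinh_div_cosh]
  simp only [id]
  field_simp

theorem sech_sq_add_tanh_sq (x : ℝ) : sech x ^ 2 + Real.tanh x ^ 2 = 1 := by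
  have hc := (Real.cosh_pos x).ne'
  rw [sech, Real.tanh_eq_sinh_div_cosh]
  field_simp
  linarith [Real.cosh_sq x]

theorem hasDerivAt_tanh_mul (k x : ℝ) :
    HasDerivAt (fun y => Real.tanh (k * y)) (k * sech (k * x) ^ 2) x := by
  have hc := (Real.cosh_pos (k * x)).ne'
  have hk := (hasDerivAt_id x).const_mul k
  have h := hk.sinh.div hk.cosh hc
  simp only [Real.tanh_eq_sinh_div_cosh]
  refine h.congr_deriv ?_
  simp only [id, sech]
  field_simp
  linear_combination k * Real.cosh_sq (k * x)

/-- the explicit soliton profile `u_c` of the one-dimensional easy-plane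
Landau–Lifshitz equation: it is `S²`-valued, satisfies the soliton ODE
`-c u_c' + u_c × (u_c'' - (u_c)₃ e₃) = 0`, and `m(x,t) = u_c(x - ct)` is a traveling-wave
solution of `∂ₜm + m × (∂ₓₓ m - m₃ e₃) = 0`. -/
theorem soliton_traveling_wave
    (c : ℝ) (hc : c ∈ Set.Ioo (-1 : ℝ) 1)
    (uc : ℝ → E3)
    (huc : ∀ x, uc x =
      toE3 ![c * sech (Real.sqrt (1 - c ^ 2) * x),
             Real.tanh (Real.sqrt (1 - c ^ 2) * x),
             Real.sqrt (1 - c ^ 2) * sech (Real.sqrt (1 - c ^ 2) * x)]) :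
    (∀ x, ‖uc x‖ = 1) ∧
    (∀ x : ℝ, -c • deriv uc x + cross (uc x) (deriv (deriv uc) x - uc x 2 • e3) = 0) ∧
    (∀ x t : ℝ,
      deriv (fun s => uc (x - c * s)) t +
        cross (uc (x - c * t))
          (deriv (deriv (fun y => uc (y - c * t))) x - uc (x - c * t) 2 • e3) = 0) := by
  set k := Real.sqrt (1 - c ^ 2)
  have hk : k ^ 2 = 1 - c ^ 2 := Real.sq_sqrt (by nlinarith [hc.1, hc.2])
  have hu (x : ℝ) : HasDerivAt uc (toE3 ![c * (-k * (sech (k * x) * Real.tanh (k * x))),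
      k * sech (k * x) ^ 2, k * (-k * (sech (k * x) * Real.tanh (k * x)))]) x := by
    rw [funext huc]
    exact hasDerivAt_toE3 ((hasDerivAt_sech_mul k x).const_mul c) (hasDerivAt_tanh_mul k x)
      ((hasDerivAt_sech_mul k x).const_mul k)
  have hd := funext fun x => (hu x).deriv
  have hdd (x : ℝ) := by
    have hS := hasDerivAt_sech_mul k x
    have hT := hasDerivAt_tanh_mul k x
    have hST := (hS.fun_mul hT).const_mul (-k)
    exact (hasDerivAt_toE3 (hST.const_mul c) ((hS.fun_pow 2).const_mul k) (hST.const_mul k)).deriv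
  have hode (x : ℝ) :
      -c • deriv uc x + cross (uc x) (deriv (deriv uc) x - uc x 2 • e3) = 0 := by
    have hST := sech_sq_add_tanh_sq (k * x)
    rw [hd, hdd, huc]
    beta_reduce
    generalize sech (k * x) = S at *
    generalize Real.tanh (k * x) = T at *
    ext i
    fin_cases i <;> simp [cross, toE3, e3]
    · linear_combination k * S * T * hk + k ^ 3 * S * T * hST
    · ring
    · linear_combination -c * k ^ 2 * S * T * hST
  refine ⟨fun x => ?_, hode, fun x t => ?_⟩
  · rw [EuclideanSpace.norm_eq, Real.sqrt_eq_one, huc]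
    simp only [toE3, Fin.sum_univ_three, Real.norm_eq_abs, sq_abs]
    simp
    linear_combination sech_sq_add_tanh_sq (k * x) + sech (k * x) ^ 2 * hk
  · have ht : deriv (fun s => uc (x - c * s)) t = -c • deriv uc (x - c * t) := by
      have hlin : HasDerivAt (fun s => x - c * s) (-c) t := by
        simpa using ((hasDerivAt_id t).const_mul c).const_sub x
      exact ((hu _).differentiableAt.hasDerivAt.scomp t hlin).deriv
    have hx : deriv (fun y => uc (y - c * t)) = fun y => deriv uc (y - c * t) :=
      funext fun y => deriv_comp_sub_const ..
    rw [ht, hx, deriv_comp_sub_const]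
    exact hode _
end
end

section
/- For c ∈ (0,1), let v_c(x) = √(1−c²) sech(√(1−c²) x) and w_c(x) = c v_c(x)/(1 − v_c(x)²). Then: (i) the energy satisfies E(v_c, w_c) = (1/2)∫_ℝ ( (v_c′)²/(1 − v_c²) + (1 − v_c²) w_c² + v_c² ) dx = 2√(1−c²); (ii) the momentum satisfies P(v_c, w_c) = ∫_ℝ v_c w_c dx = 2 arctan(√(1−c²)/c); and consequently (iii) the map c ↦ P(v_c,w_c) is differentiable on (0,1) with d/dc P(v_c,w_c) = −2/√(1−c²) < 0. -/
noncomputable section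

open Real MeasureTheory Filter Topology

/-- The first hydrodynamical component `v_c` of the soliton with speed `c`. -/
def vc (c : ℝ) (x : ℝ) : ℝ := Real.sqrt (1 - c ^ 2) * sech (Real.sqrt (1 - c ^ 2) * x)

/-- The second hydrodynamical component `w_c` of the soliton with speed `c`. -/
def wc (c : ℝ) (x : ℝ) : ℝ := c * vc c x / (1 - (vc c x) ^ 2)

/-- The momentum of the hydrodynamical soliton pair `(v_c, w_c)`. -/
def Pmom (c : ℝ) : ℝ := ∫ x : ℝ, vc c x * wc c x

theorem tendsto_tanh_atTop : Tendsto Real.tanh atTop (𝓝 1) := by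
  have h : Tendsto (fun x : ℝ => rexp (-(2 * x))) atTop (𝓝 0) :=
    tendsto_exp_neg_atTop_nhds_zero.comp (tendsto_id.const_mul_atTop two_pos)
  have key := (h.const_sub 1).div (h.const_add 1) (by norm_num)
  simp only [sub_zero, add_zero, div_one] at key
  refine key.congr fun x => ?_
  have hx : rexp (-(2 * x)) = rexp (-x) * rexp (-x) := by rw [← Real.exp_add]; ring_nf
  have hinv : rexp x * rexp (-x) = 1 := by rw [← Real.exp_add]; simp
  simp only [Pi.div_apply]
  rw [Real.tanh_eq, hx, div_eq_div_iff (by positivity) (by positivity)]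
  linear_combination (-2 * rexp (-x)) * hinv

theorem hasDerivAt_tanh (x : ℝ) : HasDerivAt Real.tanh (1 / Real.cosh x ^ 2) x := by
  have h := (Real.hasDerivAt_sinh x).div (Real.hasDerivAt_cosh x) (Real.cosh_pos x).ne'
  have e : Real.tanh = Real.sinh / Real.cosh := by
    ext y; exact Real.tanh_eq_sinh_div_cosh y
  rw [e]
  refine h.congr_deriv ?_
  rw [← Real.cosh_sq_sub_sinh_sq x]
  ring

/-- The integral over the line of an even nonnegative derivative. -/
theorem integral_eq_two_mul_of_even_of_hasDerivAt {f f' : ℝ → ℝ} {l : ℝ}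
    (heven : ∀ x, f' (-x) = f' x) (hderiv : ∀ x, HasDerivAt f (f' x) x)
    (hnonneg : ∀ x, 0 ≤ f' x) (h0 : f 0 = 0) (hlim : Tendsto f atTop (𝓝 l)) :
    ∫ x, f' x = 2 * l := by
  have habs : ∀ x, f' |x| = f' x := fun x => by
    rcases abs_choice x with h | h <;> simp [h, heven]
  have h := integral_Ioi_of_hasDerivAt_of_nonneg' (a := 0) (fun x _ => hderiv x)
    (fun x _ => hnonneg x) hlim
  have h2 := integral_comp_abs (f := f')
  simp only [habs] at h2
  rw [h2, h, h0, sub_zero]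

theorem one_sub_sq_pos {c : ℝ} (hc : c ∈ Set.Ioo (0 : ℝ) 1) : 0 < 1 - c ^ 2 := by
  nlinarith [hc.1, hc.2]

theorem hasDerivAt_vc (c x : ℝ) :
    HasDerivAt (vc c) (-(√(1 - c ^ 2) ^ 2 * Real.sinh (√(1 - c ^ 2) * x)
      / Real.cosh (√(1 - c ^ 2) * x) ^ 2)) x := by
  have hs := (hasDerivAt_id x).const_mul √(1 - c ^ 2)
  have h := (hs.cosh.fun_inv (Real.cosh_pos _).ne').const_mul √(1 - c ^ 2)
  have e : vc c = fun y => √(1 - c ^ 2) * (Real.cosh (√(1 - c ^ 2) * id y))⁻¹ := by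
    ext y; simp [vc, sech]
  rw [e]
  refine h.congr_deriv ?_
  simp only [id]
  ring

theorem cosh_sq_sub_pos {c : ℝ} (hc : c ∈ Set.Ioo (0 : ℝ) 1) (y : ℝ) :
    0 < Real.cosh y ^ 2 - √(1 - c ^ 2) ^ 2 := by
  rw [Real.sq_sqrt (one_sub_sq_pos hc).le, Real.cosh_sq]
  nlinarith [hc.1, sq_nonneg (Real.sinh y)]

theorem one_sub_vc_sq (c x : ℝ) :
    1 - vc c x ^ 2 = (Real.cosh (√(1 - c ^ 2) * x) ^ 2 - √(1 - c ^ 2) ^ 2)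
      / Real.cosh (√(1 - c ^ 2) * x) ^ 2 := by
  have := (Real.cosh_pos (√(1 - c ^ 2) * x)).ne'
  simp only [vc, sech]
  field_simp

/-- The energy density of the soliton. -/
theorem energy_density_vc {c : ℝ} (hc : c ∈ Set.Ioo (0 : ℝ) 1) (x : ℝ) :
    (deriv (vc c) x) ^ 2 / (1 - (vc c x) ^ 2)
        + (1 - (vc c x) ^ 2) * (wc c x) ^ 2 + (vc c x) ^ 2
      = 2 * (√(1 - c ^ 2) * (1 / Real.cosh (√(1 - c ^ 2) * x) ^ 2 * √(1 - c ^ 2))) := by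
  rw [(hasDerivAt_vc c x).deriv, wc, one_sub_vc_sq]
  simp only [vc, sech]
  have hC := (Real.cosh_pos (√(1 - c ^ 2) * x)).ne'
  have hD := (cosh_sq_sub_pos hc (√(1 - c ^ 2) * x)).ne'
  have hS := Real.sinh_sq (√(1 - c ^ 2) * x)
  have hs : c ^ 2 = 1 - √(1 - c ^ 2) ^ 2 := by
    rw [Real.sq_sqrt (one_sub_sq_pos hc).le]; ring
  generalize Real.cosh (√(1 - c ^ 2) * x) = C at *
  generalize Real.sinh (√(1 - c ^ 2) * x) = S at *
  generalize √(1 - c ^ 2) = s at *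
  field_simp
  rw [hS, hs]
  ring

/-- The momentum density of the soliton. -/
theorem vc_mul_wc {c : ℝ} (hc : c ∈ Set.Ioo (0 : ℝ) 1) (x : ℝ) :
    vc c x * wc c x
      = c * √(1 - c ^ 2) ^ 2 / (Real.cosh (√(1 - c ^ 2) * x) ^ 2 - √(1 - c ^ 2) ^ 2) := by
  rw [wc, one_sub_vc_sq]
  simp only [vc, sech]
  have hC := (Real.cosh_pos (√(1 - c ^ 2) * x)).ne'
  have hD := (cosh_sq_sub_pos hc (√(1 - c ^ 2) * x)).ne'
  field_simp

theorem hasDerivAt_tanh_const_mul (s x : ℝ) :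
    HasDerivAt (fun y => Real.tanh (s * y)) (1 / Real.cosh (s * x) ^ 2 * s) x :=
  (hasDerivAt_tanh (s * x)).comp x (by simpa using (hasDerivAt_id x).const_mul s)

theorem tendsto_tanh_const_mul {s : ℝ} (hs : 0 < s) :
    Tendsto (fun y => Real.tanh (s * y)) atTop (𝓝 1) :=
  tendsto_tanh_atTop.comp (tendsto_id.const_mul_atTop hs)

theorem integral_energy_density {c : ℝ} (hc : c ∈ Set.Ioo (0 : ℝ) 1) :
    ∫ x : ℝ, ((deriv (vc c) x) ^ 2 / (1 - (vc c x) ^ 2)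
        + (1 - (vc c x) ^ 2) * (wc c x) ^ 2 + (vc c x) ^ 2) = 2 * (2 * √(1 - c ^ 2)) := by
  have hs := Real.sqrt_pos.2 (one_sub_sq_pos hc)
  simp only [energy_density_vc hc]
  refine integral_eq_two_mul_of_even_of_hasDerivAt
    (f := fun x => 2 * (√(1 - c ^ 2) * Real.tanh (√(1 - c ^ 2) * x))) (fun x => ?_) (fun x => ?_)
    (fun x => by positivity) (by simp) ?_
  · rw [mul_neg, Real.cosh_neg]
  · exact ((hasDerivAt_tanh_const_mul _ x).const_mul _).const_mul _
  · simpa using ((tendsto_tanh_const_mul hs).const_mul √(1 - c ^ 2)).const_mul 2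

theorem Pmom_eq_arctan {c : ℝ} (hc : c ∈ Set.Ioo (0 : ℝ) 1) :
    Pmom c = 2 * Real.arctan (√(1 - c ^ 2) / c) := by
  have hs := Real.sqrt_pos.2 (one_sub_sq_pos hc)
  have hc0 := hc.1
  simp only [Pmom, vc_mul_wc hc]
  refine integral_eq_two_mul_of_even_of_hasDerivAt
    (f := fun x => Real.arctan (√(1 - c ^ 2) / c * Real.tanh (√(1 - c ^ 2) * x)))
    (fun x => ?_) (fun x => ?_) (fun x => ?_) (by simp) ?_
  · rw [mul_neg, Real.cosh_neg]
  · refine ((hasDerivAt_tanh_const_mul _ x).const_mul (√(1 - c ^ 2) / c)).arctan.congr_deriv ?_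
    rw [Real.tanh_eq_sinh_div_cosh]
    have hC := (Real.cosh_pos (√(1 - c ^ 2) * x)).ne'
    have hD := (cosh_sq_sub_pos hc (√(1 - c ^ 2) * x)).ne'
    have hS := Real.sinh_sq (√(1 - c ^ 2) * x)
    have hs2 : c ^ 2 = 1 - √(1 - c ^ 2) ^ 2 := by
      rw [Real.sq_sqrt (one_sub_sq_pos hc).le]; ring
    generalize Real.cosh (√(1 - c ^ 2) * x) = C at *
    generalize Real.sinh (√(1 - c ^ 2) * x) = S at *
    generalize √(1 - c ^ 2) = s at *
    have hE : 1 + (s / c * (S / C)) ^ 2 = (C ^ 2 - s ^ 2) / (c ^ 2 * C ^ 2) := by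
      field_simp
      rw [hS, hs2]
      ring
    rw [hE]
    field_simp
  · have := cosh_sq_sub_pos hc (√(1 - c ^ 2) * x)
    positivity
  · have h := (tendsto_tanh_const_mul hs).const_mul (√(1 - c ^ 2) / c)
    rw [mul_one] at h
    exact (Real.continuous_arctan.tendsto _).comp h

theorem hasDerivAt_Pmom {c : ℝ} (hc : c ∈ Set.Ioo (0 : ℝ) 1) :
    HasDerivAt Pmom (-2 / √(1 - c ^ 2)) c := by
  have h := (Real.hasDerivAt_arccos (x := c) (by linarith [hc.1]) hc.2.ne).const_mul 2
  refine (h.congr_deriv (by ring)).congr_of_eventuallyEq ?_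
  filter_upwards [isOpen_Ioo.mem_nhds hc] with x hx
  rw [Pmom_eq_arctan hx, Real.arccos_eq_arctan hx.1]

/-- energy and momentum of the hydrodynamical soliton `(v_c, w_c)`,
and the derivative of the momentum with respect to the speed. -/
theorem soliton_energy_momentum
    (c : ℝ) (hc : c ∈ Set.Ioo (0 : ℝ) 1) :
    ((1 / 2) * ∫ x : ℝ,
        ((deriv (vc c) x) ^ 2 / (1 - (vc c x) ^ 2)
          + (1 - (vc c x) ^ 2) * (wc c x) ^ 2 + (vc c x) ^ 2))
      = 2 * Real.sqrt (1 - c ^ 2) ∧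
    Pmom c = 2 * Real.arctan (Real.sqrt (1 - c ^ 2) / c) ∧
    HasDerivAt Pmom (-2 / Real.sqrt (1 - c ^ 2)) c ∧
    -2 / Real.sqrt (1 - c ^ 2) < 0 := by
  have hs := Real.sqrt_pos.2 (one_sub_sq_pos hc)
  refine ⟨?_, Pmom_eq_arctan hc, hasDerivAt_Pmom hc, div_neg_of_neg_of_pos (by norm_num) hs⟩
  rw [integral_energy_density hc]
  ring
end
end

section
/- Let ε > 0 and let m = (m₁,m₂,m₃) : ℝᴺ × I → S² be a smooth solution of the Landau–Lifshitz equation ∂ₜm + m × (Δm − (1/ε)(m₁ e₁ + m₃ e₃)) = 0 such that m₂(x,t) > 0 for all (x,t). Define Ψ_ε(x,t) = ε^{−1/2}(m₁(x,t) + i m₃(x,t)) e^{it/ε}. Then ε|Ψ_ε|² < 1 everywhere, m₂ = (1 − ε|Ψ_ε|²)^{1/2}, and Ψ_ε satisfies pointwise the equation i ∂ₜΨ_ε + (1 − ε|Ψ_ε|²)^{1/2} ΔΨ_ε + |Ψ_ε|²/(1 + (1 − ε|Ψ_ε|²)^{1/2}) · Ψ_ε + ε div( ⟨Ψ_ε,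 ∇Ψ_ε⟩_ℂ / (1 − ε|Ψ_ε|²)^{1/2} ) Ψ_ε = 0, where ⟨z₁,z₂⟩_ℂ = Re(z₁ z̄₂). -/
noncomputable section

open Real MeasureTheory Filter Topology

theorem pd_clm_comp {N : ℕ} {V W : Type*} [NormedAddCommGroup V] [NormedSpace ℝ V]
    [NormedAddCommGroup W] [NormedSpace ℝ W] (L : V →L[ℝ] W)
    {f : EuclideanSpace ℝ (Fin N) → V} (hf : Differentiable ℝ f) (j : Fin N) :
    pd (fun y => L (f y)) j = fun y => L (pd f j y) := by
  funext y
  have h := (L.hasFDerivAt.comp y (hf y).hasFDerivAt).fderiv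
  simp only [pd]
  exact congrArg (fun T => T (EuclideanSpace.single j 1)) h

theorem differentiable_pd {N : ℕ} {V : Type*} [NormedAddCommGroup V] [NormedSpace ℝ V]
    {f : EuclideanSpace ℝ (Fin N) → V} (hf : ContDiff ℝ 2 f) (j : Fin N) :
    Differentiable ℝ (pd f j) :=
  ((hf.fderiv_right (m := 1) (by norm_num)).differentiable (by norm_num)).clm_apply
    (differentiable_const _)

theorem lap_clm_comp {N : ℕ} {V W : Type*} [NormedAddCommGroup V] [NormedSpace ℝ V]
    [NormedAddCommGroup W] [NormedSpace ℝ W] (L : V →L[ℝ] W)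
    {f : EuclideanSpace ℝ (Fin N) → V} (hf : ContDiff ℝ 2 f) (x : EuclideanSpace ℝ (Fin N)) :
    lap (fun y => L (f y)) x = L (lap f x) := by
  simp only [lap, map_sum]
  refine Finset.sum_congr rfl fun j _ => ?_
  rw [pd_clm_comp L (hf.differentiable (by norm_num)), pd_clm_comp L (differentiable_pd hf j)]

/-- The real-linear map `v ↦ k (v₁ + i v₃)`. -/
def planeMap (k : ℂ) : E3 →L[ℝ] ℂ :=
  k • (Complex.ofRealCLM.comp (EuclideanSpace.proj 0)
    + Complex.I • Complex.ofRealCLM.comp (EuclideanSpace.proj 2))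

theorem planeMap_apply (k : ℂ) (v : E3) :
    planeMap k v = k * ((v 0 : ℂ) + (v 2 : ℂ) * Complex.I) := by
  simp [planeMap, mul_add, mul_comm Complex.I]

/-- On the unit sphere, the first and third components determine the square of the second. -/
theorem sq_add_sq_of_norm_eq_one {v : E3} (hv : ‖v‖ = 1) :
    v 0 ^ 2 + v 2 ^ 2 = 1 - v 1 ^ 2 := by
  have h := EuclideanSpace.norm_sq_eq v
  simp only [hv, Fin.sum_univ_three, Real.norm_eq_abs, sq_abs] at h
  linarith

/-- On the sphere, the radial part of the derivative of `k (v₁ + i v₃)` is controlled by the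
derivative of the second component. -/
theorem re_planeMap_mul_conj_pd {N : ℕ} {f : EuclideanSpace ℝ (Fin N) → E3}
    (hf : Differentiable ℝ f) (hsph : ∀ y, ‖f y‖ = 1) (k : ℂ) (j : Fin N)
    (y : EuclideanSpace ℝ (Fin N)) :
    (planeMap k (f y) * (starRingEnd ℂ) (planeMap k (pd f j y))).re
      = -(Complex.normSq k * (f y 1 * pd f j y 1)) := by
  have hinner : inner ℝ (f y) (pd f j y) = 0 := by
    have h1 := ((hf y).hasFDerivAt.norm_sq).fderiv
    have h2 : (fun z => ‖f z‖ ^ 2) = fun _ => (1 : ℝ) := by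
      funext z
      rw [hsph z, one_pow]
    rw [h2] at h1
    have h3 := congrArg (fun T => T (EuclideanSpace.single j 1)) h1
    simpa [pd] using h3.symm
  rw [PiLp.inner_apply, Fin.sum_univ_three] at hinner
  simp only [RCLike.inner_apply, conj_trivial] at hinner
  rw [planeMap_apply, planeMap_apply, map_mul, mul_mul_mul_comm, Complex.mul_conj]
  simp
  linear_combination Complex.normSq k * hinner

/-- for a smooth solution of the Landau–Lifshitz equation with strong easy-axis
anisotropy `λ₁ = λ₃ = 1/ε` along `e₂` and `m₂ > 0`, the rescaled function
`Ψ_ε = ε^{-1/2}(m₁ + i m₃)e^{it/ε}` satisfies `ε|Ψ_ε|² < 1`, `m₂ = (1-ε|Ψ_ε|²)^{1/2}`,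
and the equation (NLS_ε). -/
theorem strong_easy_axis_NLS
    (N : ℕ) (hN : 1 ≤ N) (ε : ℝ) (hε : 0 < ε)
    (I : Set ℝ) (hIopen : IsOpen I) (hIconn : I.OrdConnected)
    (m : EuclideanSpace ℝ (Fin N) → ℝ → E3)
    (hsmooth : ContDiffOn ℝ (⊤ : ℕ∞)
      (fun p : EuclideanSpace ℝ (Fin N) × ℝ => m p.1 p.2) (Set.univ ×ˢ I))
    (hsph : ∀ x, ∀ t ∈ I, ‖m x t‖ = 1)
    (hLL : ∀ x, ∀ t ∈ I,
      deriv (m x) t +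
        cross (m x t)
          (lap (fun y => m y t) x - (1 / ε) • (m x t 0 • e1 + m x t 2 • e3)) = 0)
    (hm2 : ∀ x, ∀ t ∈ I, 0 < m x t 1)
    (Ψ : EuclideanSpace ℝ (Fin N) → ℝ → ℂ)
    (hΨ : ∀ x t, Ψ x t =
      ((1 / Real.sqrt ε : ℝ) : ℂ) * ((m x t 0 : ℂ) + (m x t 2 : ℂ) * Complex.I)
        * Complex.exp (Complex.I * ((t / ε : ℝ) : ℂ))) :
    ∀ x, ∀ t ∈ I,
      (ε * Complex.normSq (Ψ x t) < 1) ∧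
      (m x t 1 = Real.sqrt (1 - ε * Complex.normSq (Ψ x t))) ∧
      (Complex.I * deriv (Ψ x) t
        + ((Real.sqrt (1 - ε * Complex.normSq (Ψ x t)) : ℝ) : ℂ) * lap (fun y => Ψ y t) x
        + ((Complex.normSq (Ψ x t) / (1 + Real.sqrt (1 - ε * Complex.normSq (Ψ x t))) : ℝ) : ℂ)
            * Ψ x t
        + (ε : ℂ) *
            ((∑ j, pd (fun y =>
                (Ψ y t * (starRingEnd ℂ) (pd (fun z => Ψ z t) j y)).re
                  / Real.sqrt (1 - ε * Complex.normSq (Ψ y t))) j x : ℝ) : ℂ)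
            * Ψ x t = 0) := by
  have hslice : ∀ t ∈ I, ContDiff ℝ 2 (fun y => m y t) := by
    intro t ht
    rw [← contDiffOn_univ]
    exact (hsmooth.of_le (WithTop.coe_le_coe.2 le_top)).comp
      (contDiff_id.prodMk contDiff_const).contDiffOn (fun y _ => ⟨Set.mem_univ _, ht⟩)
  have htime : ∀ x, ∀ t ∈ I, HasDerivAt (m x) (deriv (m x) t) t := by
    intro x t ht
    have h1 : ContDiffOn ℝ (⊤ : ℕ∞) (m x) I :=
      hsmooth.comp (contDiff_const.prodMk contDiff_id).contDiffOn
        (fun s hs => ⟨Set.mem_univ x, hs⟩)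
    exact ((h1.differentiableOn (by simp)).differentiableAt (hIopen.mem_nhds ht)).hasDerivAt
  have hεC : (ε : ℂ) ≠ 0 := by exact_mod_cast hε.ne'
  intro x t ht
  set k : ℂ := ((1 / Real.sqrt ε : ℝ) : ℂ) * Complex.exp (Complex.I * ((t / ε : ℝ) : ℂ)) with hk
  have hkn : Complex.normSq k = 1 / ε := by
    rw [hk, map_mul, Complex.normSq_ofReal, Complex.normSq_eq_norm_sq, mul_comm Complex.I,
      Complex.norm_exp_ofReal_mul_I, div_mul_div_comm, Real.mul_self_sqrt hε.le]
    ring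
  have hΨk : ∀ y, Ψ y t = planeMap k (m y t) := by
    intro y
    rw [hΨ, planeMap_apply, hk]
    ring
  have hnorm : ∀ y, 1 - ε * Complex.normSq (Ψ y t) = m y t 1 ^ 2 := by
    intro y
    rw [hΨk, planeMap_apply, map_mul, hkn, Complex.normSq_add_mul_I,
      sq_add_sq_of_norm_eq_one (hsph y t ht)]
    field_simp
    ring
  have hsqrt : ∀ y, Real.sqrt (1 - ε * Complex.normSq (Ψ y t)) = m y t 1 := by
    intro y
    rw [hnorm, Real.sqrt_sq (hm2 y t ht).le]
  have hpos : 0 < m x t 1 := hm2 x t ht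
  refine ⟨by nlinarith [hnorm x], (hsqrt x).symm, ?_⟩
  have hdiff : Differentiable ℝ (fun y => m y t) := (hslice t ht).differentiable (by norm_num)
  have hpot : Complex.normSq (Ψ x t) / (1 + m x t 1) = (1 - m x t 1) / ε := by
    have := hnorm x
    rw [div_eq_div_iff (by positivity) hε.ne']
    linarith
  have hlapΨ : lap (fun y => Ψ y t) x = planeMap k (lap (fun y => m y t) x) := by
    simp only [hΨk]
    exact lap_clm_comp (planeMap k) (hslice t ht) x
  have hdiv : (∑ j, pd (fun y =>
      (Ψ y t * (starRingEnd ℂ) (pd (fun z => Ψ z t) j y)).re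
        / Real.sqrt (1 - ε * Complex.normSq (Ψ y t))) j x)
      = -(1 / ε) * lap (fun y => m y t) x 1 := by
    have hflux : ∀ j, (fun y => (Ψ y t * (starRingEnd ℂ) (pd (fun z => Ψ z t) j y)).re
        / Real.sqrt (1 - ε * Complex.normSq (Ψ y t)))
        = fun y => (-(1 / ε) • EuclideanSpace.proj (𝕜 := ℝ) (1 : Fin 3) : E3 →L[ℝ] ℝ)
            (pd (fun z => m z t) j y) := by
      intro j
      funext y
      have hy : m y t 1 ≠ 0 := (hm2 y t ht).ne'
      rw [hsqrt]
      simp only [hΨk]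
      rw [pd_clm_comp (planeMap k) hdiff,
        re_planeMap_mul_conj_pd hdiff (fun z => hsph z t ht), hkn]
      simp
      field_simp
    simp only [hflux, pd_clm_comp _ (differentiable_pd (hslice t ht) _)]
    rw [← map_sum]
    simp [lap, Finset.mul_sum]
  have hderiv : deriv (Ψ x) t
      = planeMap k (deriv (m x) t) + planeMap k (m x t) * (Complex.I / ε) := by
    have hexp : HasDerivAt (fun s : ℝ => Complex.exp (Complex.I * ((s / ε : ℝ) : ℂ)))
        (Complex.exp (Complex.I * ((t / ε : ℝ) : ℂ)) * (Complex.I * ((1 / ε : ℝ) : ℂ))) t :=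
      ((((hasDerivAt_id t).div_const ε).ofReal_comp).const_mul Complex.I).cexp
    have hplane : HasDerivAt (fun s => planeMap ((1 / Real.sqrt ε : ℝ) : ℂ) (m x s))
        (planeMap ((1 / Real.sqrt ε : ℝ) : ℂ) (deriv (m x) t)) t :=
      (planeMap _).hasFDerivAt.comp_hasDerivAt t (htime x t ht)
    have hfun : Ψ x = fun s => planeMap ((1 / Real.sqrt ε : ℝ) : ℂ) (m x s)
        * Complex.exp (Complex.I * ((s / ε : ℝ) : ℂ)) := by
      funext s
      rw [hΨ, planeMap_apply]
    rw [hfun, HasDerivAt.deriv (hplane.fun_mul hexp)]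
    simp only [planeMap_apply, hk]
    push_cast
    ring
  rw [hsqrt, hpot, hdiv, hlapΨ, hderiv, hΨk]
  have hLL0 := congrArg (fun v : E3 => ((v 0 : ℝ) : ℂ)) (hLL x t ht)
  have hLL2 := congrArg (fun v : E3 => ((v 2 : ℝ) : ℂ)) (hLL x t ht)
  simp [cross, toE3, e1, e3] at hLL0 hLL2
  simp only [planeMap_apply]
  push_cast
  field_simp
  field_simp at hLL0 hLL2
  linear_combination k * Complex.I * hLL0 - k * hLL2
    + k * (ε * (deriv (m x) t 2 : ℂ) + (m x t 0 : ℂ) + Complex.I * (m x t 2 : ℂ)) * Complex.I_sq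
end
end

section
/- Let α ∈ [0,1] and β = √(1−α²). If m ∈ C²(ℝ; S²) is a solution of the expander profile equation α m″ + α|m′|² m + β (m × m′)′ + (x/2) m′ = 0 on ℝ, then m ∈ C^∞(ℝ; S²) and there exists c ≥ 0 such that |m′(x)| = c e^{−αx²/4} for all x ∈ ℝ. -/
noncomputable section

open Real MeasureTheory Filter Topology

/-- The cross product as a continuous bilinear map. -/
def crossCLM : E3 →L[ℝ] E3 →L[ℝ] E3 :=
  LinearMap.toContinuousBilinearMap <| LinearMap.mk₂ ℝ cross
    (by intro a b c; ext i; fin_cases i <;> simp [cross, toE3] <;> ring)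
    (by intro r a b; ext i; fin_cases i <;> simp [cross, toE3] <;> ring)
    (by intro a b c; ext i; fin_cases i <;> simp [cross, toE3] <;> ring)
    (by intro r a b; ext i; fin_cases i <;> simp [cross, toE3] <;> ring)

lemma crossCLM_apply (a b : E3) : crossCLM a b = cross a b := by
  simp [crossCLM]

lemma cross_self_eq_zero (a : E3) : cross a a = 0 := by
  ext i; fin_cases i <;> simp [cross, toE3] <;> ring

lemma inner_cross_right_self (a b : E3) : inner ℝ b (cross a b) = 0 := by
  simp [cross, toE3, PiLp.inner_apply, Fin.sum_univ_three]
  ring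

lemma HasDerivAt.cross {f g : ℝ → E3} {f' g' : E3} {x : ℝ}
    (hf : HasDerivAt f f' x) (hg : HasDerivAt g g' x) :
    HasDerivAt (fun y => cross (f y) (g y)) (cross (f x) g' + cross f' (g x)) x := by
  simpa only [crossCLM_apply] using crossCLM.hasDerivAt_of_bilinear (fun _ => hf) (fun _ => hg)

lemma ContDiff.cross {f g : ℝ → E3} {n : WithTop ℕ∞}
    (hf : ContDiff ℝ n f) (hg : ContDiff ℝ n g) :
    ContDiff ℝ n (fun y => cross (f y) (g y)) := by
  have h : ContDiff ℝ n fun y => crossCLM (f y) (g y) :=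
    (crossCLM.contDiff.comp hf).clm_apply hg
  simpa only [crossCLM_apply] using h

lemma inner_eq_zero_of_norm_eq_one {f : ℝ → E3} {f' : E3} {x : ℝ}
    (hf : HasDerivAt f f' x) (h : ∀ y, ‖f y‖ = 1) : inner ℝ (f x) f' = 0 := by
  have h1 : HasDerivAt (fun y => inner ℝ (f y) (f y)) _ x := hf.inner ℝ hf
  have h2 : (fun y => (inner ℝ (f y) (f y) : ℝ)) = fun _ => 1 := by
    funext y; simp [h y]
  rw [h2] at h1
  have h3 := h1.unique (hasDerivAt_const x 1)
  rw [real_inner_comm (f x) f'] at h3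
  linarith [real_inner_comm (f x) f']

/-- Solving the profile equation at a point for the second derivative `w`. -/
lemma profile_solve {α β s : ℝ} {a u w : E3} (hab : α ^ 2 + β ^ 2 = 1) (ha : ‖a‖ = 1)
    (haw : inner ℝ a w = -‖u‖ ^ 2)
    (h : α • w + (α * ‖u‖ ^ 2) • a + β • cross a w + s • u = 0) :
    w = -(‖u‖ ^ 2 • a) - s • (α • u - β • cross a u) := by
  have ha' : a 0 ^ 2 + a 1 ^ 2 + a 2 ^ 2 = 1 := by
    have := EuclideanSpace.real_norm_sq_eq a
    rw [ha, Fin.sum_univ_three] at this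
    linarith
  simp only [PiLp.inner_apply, Fin.sum_univ_three, RCLike.inner_apply, conj_trivial] at haw
  have h0 := congrArg (fun v : E3 => v 0) h
  have h1 := congrArg (fun v : E3 => v 1) h
  have h2 := congrArg (fun v : E3 => v 2) h
  simp [cross, toE3] at h0 h1 h2
  generalize ‖u‖ ^ 2 = q at *
  ext i
  fin_cases i <;> simp [cross, toE3]
  · linear_combination α * h0 - β * (a 1 * h2 - a 2 * h1) - (w 0 + q * a 0) * hab
      - β ^ 2 * w 0 * ha' + β ^ 2 * a 0 * haw
  · linear_combination α * h1 - β * (a 2 * h0 - a 0 * h2) - (w 1 + q * a 1) * hab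
      - β ^ 2 * w 1 * ha' + β ^ 2 * a 1 * haw
  · linear_combination α * h2 - β * (a 0 * h1 - a 1 * h0) - (w 2 + q * a 2) * hab
      - β ^ 2 * w 2 * ha' + β ^ 2 * a 2 * haw

lemma contDiff_of_profile {α β : ℝ} {m : ℝ → E3} (hreg : ContDiff ℝ 2 m)
    (h : ∀ x, deriv (deriv m) x = -(‖deriv m x‖ ^ 2 • m x)
      - (x / 2) • (α • deriv m x - β • cross (m x) (deriv m x))) :
    ContDiff ℝ (⊤ : ℕ∞) m := by
  have hd : ContDiff ℝ 1 (deriv m) :=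
    (contDiff_succ_iff_deriv.1 (show ContDiff ℝ (1 + 1) m by simpa [one_add_one_eq_two])).2.2
  have hm : Differentiable ℝ m := hreg.differentiable (by norm_num)
  have hu : Differentiable ℝ (deriv m) := hd.differentiable (by norm_num)
  suffices hn : ∀ n : ℕ, ContDiff ℝ n m ∧ ContDiff ℝ n (deriv m) from
    contDiff_infty.2 fun n => (hn n).1
  intro n
  induction n with
  | zero => exact ⟨hreg.of_le (by norm_num), hd.of_le (by norm_num)⟩
  | succ k ih =>
    obtain ⟨h1, h2⟩ := ih
    push_cast
    refine ⟨contDiff_succ_iff_deriv.2 ⟨hm, by simp, h2⟩,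
      contDiff_succ_iff_deriv.2 ⟨hu, by simp, ?_⟩⟩
    rw [funext h]
    exact ((h2.norm_sq ℝ).smul h1).neg.sub ((contDiff_id.div_const 2).smul
      ((h2.const_smul α).sub ((h1.cross h2).const_smul β)))

/-- The integrated form of `⟪u, u'⟫ = -(α x / 2) ‖u‖²`. -/
lemma norm_eq_gaussian {α : ℝ} {u u' : ℝ → E3} (hu : ∀ x, HasDerivAt u (u' x) x)
    (h : ∀ x, inner ℝ (u x) (u' x) = -(α * x / 2) * ‖u x‖ ^ 2) (x : ℝ) :
    ‖u x‖ = ‖u 0‖ * Real.exp (-α * x ^ 2 / 4) := by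
  have hF : ∀ y, HasDerivAt (fun z => ‖u z‖ ^ 2 * Real.exp (α * z ^ 2 / 2)) 0 y := by
    intro y
    have he : HasDerivAt (fun z : ℝ => α * z ^ 2 / 2) (α * y) y := by
      refine ((((hasDerivAt_id y).pow 2).const_mul α).div_const 2).congr_deriv ?_
      simp
      ring
    refine ((hu y).norm_sq.mul he.exp).congr_deriv ?_
    rw [h y]
    ring
  have hc := is_const_of_deriv_eq_zero (fun y => (hF y).differentiableAt)
    (fun y => (hF y).deriv) x 0
  simp at hc
  refine (sq_eq_sq₀ (norm_nonneg _) (by positivity)).1 ?_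
  rw [mul_pow, ← hc, mul_assoc, ← Real.exp_nat_mul, ← Real.exp_add]
  ring_nf
  simp

/-- rigidity for the expander profile equation of the one-dimensional LLG
equation: any `C²`, `S²`-valued solution is smooth and the modulus of its derivative is
`c e^{-αx²/4}` for some `c ≥ 0`. -/
theorem expander_profile_rigidity
    (α β : ℝ) (hα : α ∈ Set.Icc (0 : ℝ) 1) (hβ : β = Real.sqrt (1 - α ^ 2))
    (m : ℝ → E3)
    (hreg : ContDiff ℝ 2 m)
    (hsph : ∀ x, ‖m x‖ = 1)
    (hode : ∀ x : ℝ,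
      α • deriv (deriv m) x + (α * ‖deriv m x‖ ^ 2) • m x
        + β • deriv (fun y => cross (m y) (deriv m y)) x + (x / 2) • deriv m x = 0) :
    ContDiff ℝ (⊤ : ℕ∞) m ∧
    ∃ c : ℝ, 0 ≤ c ∧ ∀ x : ℝ, ‖deriv m x‖ = c * Real.exp (-α * x ^ 2 / 4) := by
  have hd : ContDiff ℝ 1 (deriv m) :=
    (contDiff_succ_iff_deriv.1 (show ContDiff ℝ (1 + 1) m by simpa [one_add_one_eq_two])).2.2
  have hm : ∀ x, HasDerivAt m (deriv m x) x := fun x =>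
    (hreg.differentiable (by norm_num) x).hasDerivAt
  have hu : ∀ x, HasDerivAt (deriv m) (deriv (deriv m) x) x := fun x =>
    (hd.differentiable (by norm_num) x).hasDerivAt
  have hmu : ∀ x, inner ℝ (m x) (deriv m x) = 0 := fun x =>
    inner_eq_zero_of_norm_eq_one (hm x) hsph
  have hmw : ∀ x, inner ℝ (m x) (deriv (deriv m) x) = -‖deriv m x‖ ^ 2 := by
    intro x
    have h1 : HasDerivAt (fun y => inner ℝ (m y) (deriv m y)) _ x := (hm x).inner ℝ (hu x)
    rw [funext hmu] at h1
    have h2 := h1.unique (hasDerivAt_const x 0)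
    rw [real_inner_self_eq_norm_sq] at h2
    linarith
  have hab : α ^ 2 + β ^ 2 = 1 := by
    rw [hβ, Real.sq_sqrt (by nlinarith [hα.1, hα.2])]
    ring
  have hw : ∀ x, deriv (deriv m) x = -(‖deriv m x‖ ^ 2 • m x)
      - (x / 2) • (α • deriv m x - β • cross (m x) (deriv m x)) := by
    intro x
    refine profile_solve hab (hsph x) (hmw x) ?_
    have h1 := hode x
    rwa [((hm x).cross (hu x)).deriv, cross_self_eq_zero, add_zero] at h1
  refine ⟨contDiff_of_profile hreg hw, ‖deriv m 0‖, norm_nonneg _, norm_eq_gaussian hu fun x => ?_⟩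
  rw [hw x]
  simp only [inner_sub_right, inner_neg_right, inner_smul_right, real_inner_self_eq_norm_sq,
    inner_cross_right_self, real_inner_comm (m x) (deriv m x), hmu x]
  ring
end
end

section
/- Let α ∈ [0,1], β = √(1−α²), c > 0, and let m_{c,α} be the expander profile. Then: (i) the first component of m_{c,α} is an even function and the second and third components are odd functions; (ii) there exists a unit vector A⁺_{c,α} = (A₁⁺, A₂⁺, A₃⁺) ∈ S² such that m_{c,α}(x) → A⁺_{c,α} as x → +∞ and m_{c,α}(x) → A⁻_{c,α} := (A₁⁺, −A₂⁺, −A₃⁺) as x → −∞; consequently the self-similar solution m(x,t) = m_{c,α}(x/√t) satisfies lim_{t→0⁺} m(x,t) = A⁺_{c,α} for every x > 0 and lim_{t→0⁺} m(x,t) = A⁻_{c,α} for every x < 0. -/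
noncomputable section

open Real MeasureTheory Filter Topology

def e2 : E3 := EuclideanSpace.single 1 1
/-- `(m, n, b)` solves the Serret–Frenet system with curvature `k(x) = c e^{-αx²/4}`,
torsion `τ(x) = βx/2` and initial conditions `(e₁, e₂, e₃)`. -/
def IsSF (α β c : ℝ) (m n b : ℝ → E3) : Prop :=
  (∀ x : ℝ, HasDerivAt m ((c * Real.exp (-α * x ^ 2 / 4)) • n x) x) ∧
  (∀ x : ℝ, HasDerivAt n
    ((-(c * Real.exp (-α * x ^ 2 / 4))) • m x + (β * x / 2) • b x) x) ∧
  (∀ x : ℝ, HasDerivAt b ((-(β * x / 2)) • n x) x) ∧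
  m 0 = e1 ∧ n 0 = e2 ∧ b 0 = e3

/-- The vector `(A₁, -A₂, -A₃)` obtained from `A = (A₁, A₂, A₃)`. -/
def flipA (A : E3) : E3 := toE3 ![A 0, -(A 1), -(A 2)]

/-- `(u, v, w)` solves the scalar skew system with coefficients `k` and `τ`. -/
def IsSkew (k τ u v w : ℝ → ℝ) : Prop :=
  ∀ x : ℝ, HasDerivAt u (k x * v x) x ∧ HasDerivAt v (-k x * u x + τ x * w x) x ∧
    HasDerivAt w (-τ x * v x) x

/-- The Euclidean product of two solutions of a skew system is constant. -/
theorem IsSkew.inner_eq {k τ u v w u' v' w' : ℝ → ℝ} (h : IsSkew k τ u v w)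
    (h' : IsSkew k τ u' v' w') (x : ℝ) :
    u x * u' x + v x * v' x + w x * w' x = u 0 * u' 0 + v 0 * v' 0 + w 0 * w' 0 := by
  have hd : ∀ y, HasDerivAt (fun y => u y * u' y + v y * v' y + w y * w' y) 0 y := by
    intro y
    obtain ⟨h1, h2, h3⟩ := h y
    obtain ⟨h1', h2', h3'⟩ := h' y
    exact (((h1.mul h1').add (h2.mul h2')).add (h3.mul h3')).congr_deriv (by ring)
  exact is_const_of_deriv_eq_zero (fun y => (hd y).differentiableAt) (fun y => (hd y).deriv) x 0

theorem IsSkew.eq_zero {k τ u v w : ℝ → ℝ} (h : IsSkew k τ u v w)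
    (hu : u 0 = 0) (hv : v 0 = 0) (hw : w 0 = 0) (x : ℝ) : u x = 0 := by
  have := h.inner_eq h x
  rw [hu, hv, hw] at this
  nlinarith [sq_nonneg (u x), sq_nonneg (v x), sq_nonneg (w x)]

theorem IsSkew.add {k τ u v w u' v' w' : ℝ → ℝ} (h : IsSkew k τ u v w)
    (h' : IsSkew k τ u' v' w') :
    IsSkew k τ (fun x => u x + u' x) (fun x => v x + v' x) (fun x => w x + w' x) := by
  intro x
  obtain ⟨h1, h2, h3⟩ := h x
  obtain ⟨h1', h2', h3'⟩ := h' x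
  exact ⟨(h1.add h1').congr_deriv (by ring), (h2.add h2').congr_deriv (by ring),
    (h3.add h3').congr_deriv (by ring)⟩

/-- For `k` even and `τ` odd, reflecting a solution gives a solution, up to signs. -/
theorem IsSkew.reflect {k τ u v w : ℝ → ℝ} (h : IsSkew k τ u v w)
    (hk : ∀ x, k (-x) = k x) (hτ : ∀ x, τ (-x) = -τ x) (ε : ℝ) :
    IsSkew k τ (fun x => ε * u (-x)) (fun x => -ε * v (-x)) (fun x => -ε * w (-x)) := by
  intro x
  obtain ⟨h1, h2, h3⟩ := h (-x)
  have hn : HasDerivAt (fun y : ℝ => -y) (-1) x := hasDerivAt_neg x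
  refine ⟨((h1.comp x hn).const_mul ε).congr_deriv ?_,
    ((h2.comp x hn).const_mul (-ε)).congr_deriv ?_,
    ((h3.comp x hn).const_mul (-ε)).congr_deriv ?_⟩ <;> simp only [hτ, hk] <;> ring

theorem IsSkew.even {k τ u v w : ℝ → ℝ} (h : IsSkew k τ u v w)
    (hk : ∀ x, k (-x) = k x) (hτ : ∀ x, τ (-x) = -τ x) (hv : v 0 = 0) (hw : w 0 = 0) (x : ℝ) :
    u (-x) = u x := by
  have := (h.add (h.reflect hk hτ (-1))).eq_zero (by simp) (by simp [hv]) (by simp [hw]) x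
  linarith

theorem IsSkew.odd {k τ u v w : ℝ → ℝ} (h : IsSkew k τ u v w)
    (hk : ∀ x, k (-x) = k x) (hτ : ∀ x, τ (-x) = -τ x) (hu : u 0 = 0) (x : ℝ) :
    u (-x) = -u x := by
  have := (h.add (h.reflect hk hτ 1)).eq_zero (by simp [hu]) (by simp) (by simp) x
  linarith

theorem IsSF.isSkew {α β c : ℝ} {m n b : ℝ → E3} (h : IsSF α β c m n b) (i : Fin 3) :
    IsSkew (fun x => c * Real.exp (-α * x ^ 2 / 4)) (fun x => β * x / 2)
      (fun x => m x i) (fun x => n x i) (fun x => b x i) := by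
  obtain ⟨hm, hn, hb, -⟩ := h
  intro x
  refine ⟨?_, ?_, ?_⟩
  · simpa [Function.comp_def] using
      (EuclideanSpace.proj (𝕜 := ℝ) i).hasFDerivAt.comp_hasDerivAt x (hm x)
  · simpa [Function.comp_def] using
      (EuclideanSpace.proj (𝕜 := ℝ) i).hasFDerivAt.comp_hasDerivAt x (hn x)
  · simpa [Function.comp_def] using
      (EuclideanSpace.proj (𝕜 := ℝ) i).hasFDerivAt.comp_hasDerivAt x (hb x)

theorem IsSF.parity {α β c : ℝ} {m n b : ℝ → E3} (h : IsSF α β c m n b) (x : ℝ) :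
    m (-x) 0 = m x 0 ∧ m (-x) 1 = -(m x 1) ∧ m (-x) 2 = -(m x 2) := by
  have hk : ∀ x : ℝ, (fun x => c * Real.exp (-α * x ^ 2 / 4)) (-x) =
      (fun x => c * Real.exp (-α * x ^ 2 / 4)) x := fun x => by simp
  have hτ : ∀ x : ℝ, (fun x => β * x / 2) (-x) = -(fun x => β * x / 2) x := fun x => by
    simp only; ring
  obtain ⟨-, -, -, hm, hn, hb⟩ := id h
  exact ⟨(h.isSkew 0).even hk hτ (by simp [hn, e2]) (by simp [hb, e3]) x,
    (h.isSkew 1).odd hk hτ (by simp [hm, e1]) x, (h.isSkew 2).odd hk hτ (by simp [hm, e1]) x⟩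

/-- The frame `(m, n, b)` stays orthonormal; here only the unit lengths are recorded. -/
theorem IsSF.norm_eq_one {α β c : ℝ} {m n b : ℝ → E3} (h : IsSF α β c m n b) (x : ℝ) :
    ‖m x‖ = 1 ∧ ‖n x‖ = 1 ∧ ‖b x‖ = 1 := by
  let M : Matrix (Fin 3) (Fin 3) ℝ := Matrix.of ![m x, n x, b x]
  have hM : M.transpose * M = 1 := by
    ext i j
    have := (h.isSkew i).inner_eq (h.isSkew j) x
    obtain ⟨-, -, -, hm, hn, hb⟩ := id h
    simp only [hm, hn, hb] at this
    simp only [Matrix.mul_apply, Fin.sum_univ_three, Matrix.transpose_apply, M, Matrix.of_apply,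
      Matrix.cons_val]
    rw [this]
    fin_cases i <;> fin_cases j <;> simp [e1, e2, e3]
  have hM' : M * M.transpose = 1 := mul_eq_one_comm.1 hM
  have key : ∀ i, M i 0 * M i 0 + M i 1 * M i 1 + M i 2 * M i 2 = 1 := fun i => by
    simpa [Matrix.mul_apply, Fin.sum_univ_three] using congrFun (congrFun hM' i) i
  have norm_one : ∀ v : E3, v 0 * v 0 + v 1 * v 1 + v 2 * v 2 = 1 → ‖v‖ = 1 := fun v hv => by
    rw [EuclideanSpace.norm_eq, Fin.sum_univ_three, Real.sqrt_eq_one]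
    simp only [Real.norm_eq_abs, sq_abs]
    linarith
  exact ⟨norm_one _ (key 0), norm_one _ (key 1), norm_one _ (key 2)⟩

theorem IsSF.continuous {α β c : ℝ} {m n b : ℝ → E3} (h : IsSF α β c m n b) :
    Continuous n ∧ Continuous b :=
  ⟨continuous_iff_continuousAt.2 fun x => (h.2.1 x).continuousAt,
    continuous_iff_continuousAt.2 fun x => (h.2.2.1 x).continuousAt⟩

/-- For `α > 0` the derivative of `m` is dominated by a Gaussian. -/
theorem IsSF.exists_tendsto_of_pos {α β c : ℝ} {m n b : ℝ → E3} (h : IsSF α β c m n b)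
    (hα : 0 < α) : ∃ A, Tendsto m atTop (𝓝 A) := by
  have hg : Integrable fun x : ℝ => c * Real.exp (-(α / 4) * x ^ 2) :=
    (integrable_exp_neg_mul_sq (by positivity)).const_mul c
  have hi : Integrable fun x : ℝ => (c * Real.exp (-α * x ^ 2 / 4)) • n x := by
    refine hg.mono (Continuous.aestronglyMeasurable ?_) (Eventually.of_forall fun x => ?_)
    · have := h.continuous.1
      fun_prop
    · rw [norm_smul, (h.norm_eq_one x).2.1, mul_one]
      exact le_of_eq (by ring_nf)
  exact ⟨_, tendsto_limUnder_of_hasDerivAt_of_integrableOn_Ioi (a := 0) (fun x _ => h.1 x)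
    hi.integrableOn⟩

/-- For `α = 0`, `m + (2c/x) b` has an integrable derivative at infinity. -/
theorem IsSF.exists_tendsto_of_eq_zero {c : ℝ} {m n b : ℝ → E3} (h : IsSF 0 1 c m n b) :
    ∃ A, Tendsto m atTop (𝓝 A) := by
  have hd : ∀ x ∈ Set.Ioi (1 : ℝ), HasDerivAt (fun y => m y + (2 * c * y⁻¹) • b y)
      ((-(2 * c) * (x ^ 2)⁻¹) • b x) x := by
    intro x hx
    have hx0 : x ≠ 0 := (zero_lt_one.trans hx).ne'
    have hinv : HasDerivAt (fun y : ℝ => 2 * c * y⁻¹) (2 * c * -(x ^ 2)⁻¹) x :=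
      (hasDerivAt_inv hx0).const_mul _
    refine ((h.1 x).add (hinv.smul (h.2.2.1 x))).congr_deriv ?_
    ext i
    simp
    field_simp
    ring
  have hi : IntegrableOn (fun x : ℝ => (-(2 * c) * (x ^ 2)⁻¹) • b x) (Set.Ioi 1) := by
    have hg : IntegrableOn (fun x : ℝ => -(2 * c) * x ^ (-2 : ℝ)) (Set.Ioi 1) :=
      (integrableOn_Ioi_rpow_of_lt (by norm_num) one_pos).const_mul _
    refine Integrable.mono hg (ContinuousOn.aestronglyMeasurable ?_ measurableSet_Ioi)
      (ae_restrict_of_forall_mem measurableSet_Ioi fun x hx => ?_)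
    · have := h.continuous.2
      refine ContinuousOn.smul (continuousOn_const.mul (ContinuousOn.inv₀ (continuousOn_pow 2) ?_))
        this.continuousOn
      intro x hx
      exact pow_ne_zero _ (zero_lt_one.trans hx).ne'
    · rw [norm_smul, (h.norm_eq_one x).2.2, mul_one, Real.rpow_neg (zero_lt_one.trans hx).le]
      norm_num
  have hlim := tendsto_limUnder_of_hasDerivAt_of_integrableOn_Ioi hd hi
  have hb : Tendsto (fun x : ℝ => (2 * c * x⁻¹) • b x) atTop (𝓝 0) := by
    have h0 : Tendsto (fun x : ℝ => 2 * c * x⁻¹) atTop (𝓝 0) := by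
      simpa using tendsto_inv_atTop_zero.const_mul (2 * c)
    refine squeeze_zero_norm (a := fun x : ℝ => ‖2 * c * x⁻¹‖) (fun x => ?_) (by simpa using h0.norm)
    rw [norm_smul, (h.norm_eq_one x).2.2, mul_one]
  refine ⟨_, (hlim.sub hb).congr fun x => ?_⟩
  simp

theorem continuous_flipA : Continuous flipA := by
  refine (PiLp.continuous_toLp 2 _).comp (continuous_pi fun i => ?_)
  fin_cases i <;> simp <;> fun_prop

theorem IsSF.flipA_neg {α β c : ℝ} {m n b : ℝ → E3} (h : IsSF α β c m n b) (x : ℝ) :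
    flipA (m (-x)) = m x := by
  obtain ⟨h0, h1, h2⟩ := h.parity x
  ext i
  fin_cases i <;> simp [flipA, toE3, h0, h1, h2]

theorem tendsto_inv_sqrt_zero_right :
    Tendsto (fun t : ℝ => (Real.sqrt t)⁻¹) (𝓝[>] 0) atTop := by
  refine tendsto_inv_nhdsGT_zero.comp (tendsto_nhdsWithin_iff.2 ⟨?_, ?_⟩)
  · simpa using (Real.continuous_sqrt.tendsto 0).mono_left nhdsWithin_le_nhds
  · filter_upwards [self_mem_nhdsWithin] with t ht using Real.sqrt_pos.2 ht

/-- parity of the expander profile `m_{c,α}`, existence of the limit unit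
vectors `A^±_{c,α}` at `±∞`, and pointwise convergence of the self-similar solution
`m_{c,α}(x/√t)` to the jump initial condition as `t → 0⁺`. -/
theorem expander_limits_at_infinity
    (α β c : ℝ) (hα : α ∈ Set.Icc (0 : ℝ) 1) (hβ : β = Real.sqrt (1 - α ^ 2)) (hc : 0 < c)
    (m n b : ℝ → E3) (hSF : IsSF α β c m n b) :
    (∀ x : ℝ, m (-x) 0 = m x 0 ∧ m (-x) 1 = -(m x 1) ∧ m (-x) 2 = -(m x 2)) ∧
    ∃ A : E3, ‖A‖ = 1 ∧
      Tendsto m atTop (nhds A) ∧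
      Tendsto m atBot (nhds (flipA A)) ∧
      (∀ x : ℝ, 0 < x →
        Tendsto (fun t => m (x / Real.sqrt t)) (nhdsWithin 0 (Set.Ioi 0)) (nhds A)) ∧
      (∀ x : ℝ, x < 0 →
        Tendsto (fun t => m (x / Real.sqrt t)) (nhdsWithin 0 (Set.Ioi 0)) (nhds (flipA A))) := by
  refine ⟨hSF.parity, ?_⟩
  obtain ⟨A, hA⟩ : ∃ A, Tendsto m atTop (𝓝 A) := by
    rcases hα.1.eq_or_lt with h0 | h0
    · subst h0
      obtain rfl : β = 1 := by simp [hβ]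
      exact hSF.exists_tendsto_of_eq_zero
    · exact hSF.exists_tendsto_of_pos h0
  have hA' : Tendsto m atBot (𝓝 (flipA A)) :=
    ((continuous_flipA.tendsto A).comp (hA.comp tendsto_neg_atBot_atTop)).congr hSF.flipA_neg
  refine ⟨A, ?_, hA, hA', fun x hx => hA.comp ?_, fun x hx => hA'.comp ?_⟩
  · refine tendsto_nhds_unique hA.norm ?_
    simp [fun x => (hSF.norm_eq_one x).1]
  · exact tendsto_inv_sqrt_zero_right.const_mul_atTop hx
  · exact tendsto_inv_sqrt_zero_right.const_mul_atTop_of_neg hx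
end
end

section
/- Let α ∈ [0,1], β = √(1−α²), c > 0, let m_{c,α} be the expander profile, and let m⁰_{c,α} = A⁺_{c,α} χ_{(0,∞)} + A⁻_{c,α} χ_{(−∞,0)} be the step function with values the limit vectors of m_{c,α} at ±∞. Then for every p ∈ (1,∞) there exists a constant C(c,α,p) > 0 such that for all t > 0, ‖ m_{c,α}(·/√t) − m⁰_{c,α} ‖_{L^p(ℝ)} ≤ C(c,α,p) t^{1/(2p)}. -/
noncomputable section

open Real MeasureTheory Filter Topology

/-- The jump step function `m⁰ = A⁺ χ_{(0,∞)} + A⁻ χ_{(-∞,0)}` (with `A⁻ = flipA A⁺`). -/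
def jumpData (A : E3) (x : ℝ) : E3 := if 0 < x then A else flipA A

/-- The half-turn `flipA` about the first axis as a continuous linear map. -/
def flipCLM : E3 →L[ℝ] E3 :=
  LinearMap.toContinuousLinearMap
    { toFun := flipA
      map_add' := fun v w => by
        ext i
        fin_cases i <;> simp [flipA, toE3] <;> ring
      map_smul' := fun r v => by
        ext i
        fin_cases i <;> simp [flipA, toE3] }

theorem flipCLM_apply (v : E3) : flipCLM v = flipA v := rfl

theorem norm_flipCLM (v : E3) : ‖flipCLM v‖ = ‖v‖ := by
  rw [flipCLM_apply, EuclideanSpace.norm_eq, EuclideanSpace.norm_eq]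
  simp [Fin.sum_univ_three, flipA, toE3]

theorem flipCLM_e1 : flipCLM e1 = e1 := by
  ext i
  fin_cases i <;> simp [flipCLM_apply, flipA, toE3, e1]

theorem flipCLM_e2 : flipCLM e2 = -e2 := by
  ext i
  fin_cases i <;> simp [flipCLM_apply, flipA, toE3, e2]

theorem flipCLM_e3 : flipCLM e3 = -e3 := by
  ext i
  fin_cases i <;> simp [flipCLM_apply, flipA, toE3, e3]

/-- A solution of a Serret–Frenet system conserves `‖m‖² + ‖n‖² + ‖b‖²`. -/
theorem frenet_energy_conserved {V : Type*} [NormedAddCommGroup V] [InnerProductSpace ℝ V]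
    {k τ : ℝ → ℝ} {m n b : ℝ → V}
    (hm : ∀ x, HasDerivAt m (k x • n x) x)
    (hn : ∀ x, HasDerivAt n (-k x • m x + τ x • b x) x)
    (hb : ∀ x, HasDerivAt b (-τ x • n x) x) (x : ℝ) :
    ‖m x‖ ^ 2 + ‖n x‖ ^ 2 + ‖b x‖ ^ 2 = ‖m 0‖ ^ 2 + ‖n 0‖ ^ 2 + ‖b 0‖ ^ 2 := by
  have hderiv : ∀ y, HasDerivAt (fun y => ‖m y‖ ^ 2 + ‖n y‖ ^ 2 + ‖b y‖ ^ 2) 0 y := by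
    intro y
    refine (((hm y).norm_sq.add (hn y).norm_sq).add (hb y).norm_sq).congr_deriv ?_
    simp only [inner_add_right, inner_smul_right]
    rw [real_inner_comm (m y) (n y), real_inner_comm (b y) (n y)]
    ring
  exact is_const_of_deriv_eq_zero (fun y => (hderiv y).differentiableAt)
    (fun y => (hderiv y).deriv) x 0

theorem IsSF.energy_eq {α β c : ℝ} {m n b : ℝ → E3} (h : IsSF α β c m n b) (x : ℝ) :
    ‖m x‖ ^ 2 + ‖n x‖ ^ 2 + ‖b x‖ ^ 2 = 3 := by
  obtain ⟨hm, hn, hb, hm0, hn0, hb0⟩ := h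
  rw [frenet_energy_conserved (k := fun x => c * Real.exp (-α * x ^ 2 / 4))
    (τ := fun x => β * x / 2) hm hn hb x, hm0, hn0, hb0]
  simp [e1, e2, e3]
  norm_num

theorem IsSF.norm_le_two {α β c : ℝ} {m n b : ℝ → E3} (h : IsSF α β c m n b) (x : ℝ) :
    ‖m x‖ ≤ 2 ∧ ‖n x‖ ≤ 2 ∧ ‖b x‖ ≤ 2 := by
  have hE := h.energy_eq x
  refine ⟨?_, ?_, ?_⟩ <;>
    nlinarith [sq_nonneg ‖m x‖, sq_nonneg ‖n x‖, sq_nonneg ‖b x‖]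

/-- The tangent vector of the expander is equivariant under `x ↦ -x`. -/
theorem IsSF.apply_neg {α β c : ℝ} {m n b : ℝ → E3} (h : IsSF α β c m n b) (x : ℝ) :
    m (-x) = flipCLM (m x) := by
  obtain ⟨hm, hn, hb, hm0, hn0, hb0⟩ := h
  have key := frenet_energy_conserved (k := fun x => c * Real.exp (-α * x ^ 2 / 4))
    (τ := fun x => β * x / 2)
    (m := fun y => m (-y) - flipCLM (m y)) (n := fun y => -n (-y) - flipCLM (n y))
    (b := fun y => -b (-y) - flipCLM (b y)) ?_ ?_ ?_ x
  · simp only [neg_zero, hm0, hn0, hb0, flipCLM_e1, flipCLM_e2, flipCLM_e3, sub_self,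
      norm_zero] at key
    have : ‖m (-x) - flipCLM (m x)‖ ^ 2 = 0 := by
      nlinarith [sq_nonneg ‖m (-x) - flipCLM (m x)‖, sq_nonneg ‖-n (-x) - flipCLM (n x)‖,
        sq_nonneg ‖-b (-x) - flipCLM (b x)‖]
    exact sub_eq_zero.1 (norm_eq_zero.1 (pow_eq_zero_iff two_ne_zero |>.1 this))
  · intro y
    refine (((hm (-y)).scomp y (hasDerivAt_neg y)).sub
      (flipCLM.hasFDerivAt.comp_hasDerivAt y (hm y))).congr_deriv ?_
    simp only [neg_sq, map_smul]
    module
  · intro y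
    refine (((hn (-y)).scomp y (hasDerivAt_neg y)).neg.sub
      (flipCLM.hasFDerivAt.comp_hasDerivAt y (hn y))).congr_deriv ?_
    simp only [neg_sq, map_smul, map_add]
    module
  · intro y
    refine (((hb (-y)).scomp y (hasDerivAt_neg y)).neg.sub
      (flipCLM.hasFDerivAt.comp_hasDerivAt y (hb y))).congr_deriv ?_
    simp only [map_smul]
    module

/-- A derivative bound `K / x²` yields convergence to the limit at rate `K / x`. -/
theorem norm_sub_le_of_deriv_le_div_sq {V : Type*} [NormedAddCommGroup V] [NormedSpace ℝ V]
    {F F' : ℝ → V} {A : V} {K : ℝ}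
    (hF : ∀ x, 0 < x → HasDerivAt F (F' x) x) (hK : ∀ x, 0 < x → ‖F' x‖ ≤ K / x ^ 2)
    (hA : Tendsto F atTop (𝓝 A)) {x : ℝ} (hx : 0 < x) : ‖F x - A‖ ≤ K / x := by
  have hK0 : 0 ≤ K := by simpa using (norm_nonneg _).trans (hK 1 one_pos)
  have hxy : ∀ y, x ≤ y → ‖F y - F x‖ ≤ K / x := by
    intro y hy
    have hB : ∀ z, 0 < z → HasDerivAt (fun z : ℝ => K / x - K / z) (K / z ^ 2) z := by
      intro z hz
      refine (((hasDerivAt_inv hz.ne').const_mul K).const_sub (K / x)).congr_deriv ?_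
      ring
    have := image_norm_le_of_norm_deriv_right_le_deriv_boundary' (a := x) (b := y)
      (f := fun z => F z - F x) (f' := F') (B := fun z => K / x - K / z)
      (B' := fun z => K / z ^ 2)
      (fun z hz => ((hF z (hx.trans_le hz.1)).continuousAt.sub
        continuousAt_const).continuousWithinAt)
      (fun z hz => ((hF z (hx.trans_le hz.1)).sub_const _).hasDerivWithinAt)
      (by simp)
      (fun z hz => (hB z (hx.trans_le hz.1)).continuousAt.continuousWithinAt)
      (fun z hz => (hB z (hx.trans_le hz.1)).hasDerivWithinAt)
      (fun z hz => hK z (hx.trans_le hz.1)) (Set.right_mem_Icc.2 hy)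
    have hy0 : 0 ≤ K / y := div_nonneg hK0 (hx.le.trans hy)
    linarith
  rw [norm_sub_rev]
  exact le_of_tendsto (hA.sub_const (F x)).norm (eventually_ge_atTop x |>.mono hxy)

/-- The tangent vector of the expander converges to its limit at rate `O(1/x)`. -/
theorem IsSF.exists_norm_sub_le_div {α β c : ℝ} (hα : 0 ≤ α) (hβ : β = √(1 - α ^ 2))
    (hc : 0 < c) {m n b : ℝ → E3} (h : IsSF α β c m n b) {A : E3}
    (hA : Tendsto m atTop (𝓝 A)) : ∃ K, 0 ≤ K ∧ ∀ x, 0 < x → ‖m x - A‖ ≤ K / x := by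
  have hbd := h.norm_le_two
  obtain ⟨hm, -, hb, -⟩ := h
  rcases hα.eq_or_lt with rfl | hα
  · obtain rfl : β = 1 := by simpa using hβ
    refine ⟨8 * c, by positivity, fun x hx => ?_⟩
    have hinv : Tendsto (fun x : ℝ => (2 * c / x) • b x) atTop (𝓝 0) := by
      refine squeeze_zero_norm' (a := fun x : ℝ => 4 * c / x) ?_
        (tendsto_const_nhds.div_atTop tendsto_id)
      filter_upwards [eventually_gt_atTop 0] with y hy
      rw [norm_smul, Real.norm_of_nonneg (by positivity)]
      calc 2 * c / y * ‖b y‖ ≤ 2 * c / y * 2 := by gcongr; exact (hbd y).2.2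
        _ = 4 * c / y := by ring
    have key := norm_sub_le_of_deriv_le_div_sq (K := 4 * c)
      (F := fun x => m x + (2 * c / x) • b x) (F' := fun x => (-(2 * c / x ^ 2)) • b x)
      (A := A) ?_ ?_ (by simpa using hA.add hinv) hx
    · have hbx : ‖(2 * c / x) • b x‖ ≤ 4 * c / x := by
        rw [norm_smul, Real.norm_of_nonneg (by positivity)]
        calc 2 * c / x * ‖b x‖ ≤ 2 * c / x * 2 := by gcongr; exact (hbd x).2.2
          _ = 4 * c / x := by ring
      calc ‖m x - A‖ = ‖(m x + (2 * c / x) • b x - A) - (2 * c / x) • b x‖ := by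
            congr 1; abel
        _ ≤ 4 * c / x + 4 * c / x := (norm_sub_le _ _).trans (add_le_add key hbx)
        _ = 8 * c / x := by ring
    · intro y hy
      have hd : HasDerivAt (fun z : ℝ => 2 * c / z) (-(2 * c / y ^ 2)) y := by
        refine ((hasDerivAt_inv hy.ne').const_mul (2 * c)).congr_deriv ?_
        ring
      refine ((hm y).add (hd.smul (hb y))).congr_deriv ?_
      have : 2 * c / y * -(1 * y / 2) = -c := by field_simp
      rw [smul_smul, this]
      simp
    · intro y hy
      rw [norm_smul, norm_neg, Real.norm_of_nonneg (by positivity)]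
      calc 2 * c / y ^ 2 * ‖b y‖ ≤ 2 * c / y ^ 2 * 2 := by gcongr; exact (hbd y).2.2
        _ = 4 * c / y ^ 2 := by ring
  · refine ⟨8 * c / α, by positivity, fun x hx =>
      norm_sub_le_of_deriv_le_div_sq (fun y _ => hm y) (fun y hy => ?_) hA hx⟩
    have hexp : Real.exp (-α * y ^ 2 / 4) ≤ 4 / (α * y ^ 2) := by
      have hu : 0 < α * y ^ 2 / 4 := by positivity
      rw [show -α * y ^ 2 / 4 = -(α * y ^ 2 / 4) by ring, Real.exp_neg,
        show 4 / (α * y ^ 2) = (α * y ^ 2 / 4)⁻¹ by rw [inv_div]]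
      exact inv_anti₀ hu (by linarith [Real.add_one_le_exp (α * y ^ 2 / 4)])
    rw [norm_smul, Real.norm_of_nonneg (by positivity)]
    calc c * Real.exp (-α * y ^ 2 / 4) * ‖n y‖ ≤ c * (4 / (α * y ^ 2)) * 2 := by
          gcongr
          exact (hbd y).2.1
      _ = 8 * c / α / y ^ 2 := by field_simp; norm_num

theorem IsSF.exists_norm_sub_jumpData_le {α β c : ℝ} (hα : 0 ≤ α) (hβ : β = √(1 - α ^ 2))
    (hc : 0 < c) {m n b : ℝ → E3} (h : IsSF α β c m n b) {A : E3}
    (hA : Tendsto m atTop (𝓝 A)) :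
    ∃ D, 0 < D ∧ ∀ x, ‖m x - jumpData A x‖ ≤ D / (1 + |x|) := by
  obtain ⟨K, hK0, hK⟩ := h.exists_norm_sub_le_div hα hβ hc hA
  have hA2 : ‖A‖ ≤ 2 := le_of_tendsto hA.norm (Eventually.of_forall fun x => (h.norm_le_two x).1)
  have hnonneg : ∀ x, 0 ≤ x → ‖m x - A‖ ≤ (K + 4) / (1 + |x|) := by
    intro x hx
    have h4 : ‖m x - A‖ ≤ 4 := by
      linarith [norm_sub_le (m x) A, (h.norm_le_two x).1]
    rw [le_div_iff₀ (by positivity), abs_of_nonneg hx]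
    rcases hx.eq_or_lt with rfl | hx
    · linarith
    · have := (le_div_iff₀ hx).1 (hK x hx)
      linarith
  refine ⟨K + 4, by linarith, fun x => ?_⟩
  unfold jumpData
  split_ifs with hx
  · exact hnonneg x hx.le
  · have := hnonneg (-x) (by linarith)
    rwa [← norm_flipCLM, map_sub, ← h.apply_neg, neg_neg, abs_neg, flipCLM_apply] at this

/-- `L^p` norm of a rescaled function with decay `D / (1 + |x|)`. -/
theorem eLpNorm_le_of_norm_le_div_one_add_abs_div {V : Type*} [NormedAddCommGroup V]
    {f : ℝ → V} {D p s : ℝ} (hD : 0 ≤ D) (hp : 1 < p) (hs : 0 < s)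
    (hf : ∀ x, ‖f x‖ ≤ D / (1 + |x / s|)) :
    eLpNorm f (ENNReal.ofReal p) volume ≤
      ENNReal.ofReal (D * (∫ x : ℝ, (1 + ‖x‖) ^ (-p)) ^ (1 / p) * s ^ (1 / p)) := by
  have hp0 : 0 < p := one_pos.trans hp
  have h_int : Integrable (fun x : ℝ => (1 + ‖x‖) ^ (-p)) :=
    integrable_one_add_norm (by simpa using hp)
  have hI : 0 ≤ ∫ x : ℝ, (1 + ‖x‖) ^ (-p) := integral_nonneg fun x => by positivity
  have hpow : ∀ x, ‖f x‖ₑ ^ p ≤ ENNReal.ofReal (D ^ p * (1 + ‖x / s‖) ^ (-p)) := by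
    intro x
    rw [← ofReal_norm, ENNReal.ofReal_rpow_of_nonneg (norm_nonneg _) hp0.le]
    refine ENNReal.ofReal_le_ofReal ((Real.rpow_le_rpow (norm_nonneg _) (hf x) hp0.le).trans_eq ?_)
    rw [Real.div_rpow hD (by positivity), Real.rpow_neg (by positivity), div_eq_mul_inv,
      Real.norm_eq_abs]
  have h_int' : Integrable (fun x : ℝ => D ^ p * (1 + ‖x / s‖) ^ (-p)) :=
    (h_int.comp_div hs.ne').const_mul _
  rw [eLpNorm_eq_lintegral_rpow_enorm_toReal (by simpa using hp0) ENNReal.ofReal_ne_top,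
    ENNReal.toReal_ofReal hp0.le]
  calc (∫⁻ x, ‖f x‖ₑ ^ p) ^ (1 / p)
      ≤ (∫⁻ x, ENNReal.ofReal (D ^ p * (1 + ‖x / s‖) ^ (-p))) ^ (1 / p) := by
        gcongr with x
        exact hpow x
    _ = (ENNReal.ofReal (D ^ p * (s * ∫ x : ℝ, (1 + ‖x‖) ^ (-p)))) ^ (1 / p) := by
        rw [← ofReal_integral_eq_lintegral_ofReal h_int'
          (Eventually.of_forall fun x => by positivity), integral_const_mul,
          Measure.integral_comp_div (fun x : ℝ => (1 + ‖x‖) ^ (-p)) s, abs_of_pos hs, smul_eq_mul]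
    _ = ENNReal.ofReal (D * (∫ x : ℝ, (1 + ‖x‖) ^ (-p)) ^ (1 / p) * s ^ (1 / p)) := by
        rw [ENNReal.ofReal_rpow_of_nonneg (by positivity) (by positivity),
          Real.mul_rpow (by positivity) (by positivity), Real.mul_rpow hs.le hI,
          ← Real.rpow_mul hD, mul_one_div_cancel hp0.ne', Real.rpow_one]
        congr 1
        ring

/-- rate of convergence in `L^p`, `1 < p < ∞`, of the self-similar solution
`m_{c,α}(·/√t)` to the jump initial condition `m⁰_{c,α}` as `t → 0⁺`. -/
theorem expander_Lp_convergence_rate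
    (α β c : ℝ) (hα : α ∈ Set.Icc (0 : ℝ) 1) (hβ : β = Real.sqrt (1 - α ^ 2)) (hc : 0 < c)
    (m n b : ℝ → E3) (hSF : IsSF α β c m n b)
    (A : E3) (hA : Tendsto m atTop (nhds A))
    (p : ℝ) (hp : 1 < p) :
    ∃ C : ℝ, 0 < C ∧ ∀ t : ℝ, 0 < t →
      eLpNorm (fun x : ℝ => m (x / Real.sqrt t) - jumpData A x)
          (ENNReal.ofReal p) volume
        ≤ ENNReal.ofReal (C * t ^ (1 / (2 * p))) := by
  obtain ⟨D, hD, hbound⟩ := hSF.exists_norm_sub_jumpData_le hα.1 hβ hc hA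
  have hI : 0 ≤ ∫ x : ℝ, (1 + ‖x‖) ^ (-p) := integral_nonneg fun x => by positivity
  refine ⟨D * (∫ x : ℝ, (1 + ‖x‖) ^ (-p)) ^ (1 / p) + 1, by positivity, fun t ht => ?_⟩
  have hs : 0 < √t := Real.sqrt_pos.2 ht
  refine (eLpNorm_le_of_norm_le_div_one_add_abs_div hD.le hp hs fun x => ?_).trans
    (ENNReal.ofReal_le_ofReal ?_)
  · have hjump : jumpData A x = jumpData A (x / √t) := by
      simp only [jumpData, div_pos_iff_of_pos_right hs]
    rw [hjump]
    exact hbound (x / √t)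
  · rw [Real.sqrt_eq_rpow, ← Real.rpow_mul ht.le,
      show (1 / 2 : ℝ) * (1 / p) = 1 / (2 * p) by rw [one_div_mul_one_div]]
    gcongr
    linarith
end
end
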